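/- arXiv:2605.23291 — 6 statements merged into one kernel-verified Lean document; each statement's English description precedes it below -/
import Mathlib

section
/- Let M be a matroid on a finite ground set E, let 1 ≤ K ≤ rank(M), and suppose Aut(M) acts transitively on E. Let u be the uniform distribution on E. Assume there exist ε > 0 and c_loc > 0 such that F_{M,K}(u) − F_{M,K}(p) ≥ c_loc·‖p − u‖_2² for every probability distribution p on E with ‖p − u‖_2 ≤ ε. Then u is the unique maximizer of F_{M,K} on the probability simplex Δ(E), and there exists c > 0 such that F_{M,K}(u) − F_{M,K}(p) ≥ c·‖p − u‖_2² for every p ∈ Δ(E). -/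
open Finset Classical

/-- `F_{M,K}(p) = K! · ∑_{S ∈ I(M), |S| = K} ∏_{e ∈ S} p_e`. -/
noncomputable def indepProb {α : Type*} [Fintype α] (M : Matroid α) (K : ℕ)
    (p : α → ℝ) : ℝ :=
  (K.factorial : ℝ) *
    ∑ S ∈ Finset.univ.powersetCard K, if M.Indep (S : Set α) then ∏ e ∈ S, p e else 0

open Matrix in
/-- Spectral decomposition of the quadratic form of a real symmetric matrix. -/
theorem exists_eigenvectors_quadraticForm {ι : Type*} [Fintype ι] {B : Matrix ι ι ℝ}
    (hB : B.IsSymm) : ∃ (v : ι → ι → ℝ) (μ : ι → ℝ), (∀ i, B *ᵥ v i = μ i • v i) ∧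
      (∀ i, v i ⬝ᵥ v i = 1) ∧ ∀ z, z ⬝ᵥ B *ᵥ z = ∑ i, μ i * (z ⬝ᵥ v i) ^ 2 := by
  have hH : B.IsHermitian := by
    rw [Matrix.IsHermitian, conjTranspose_eq_transpose_of_trivial]; exact hB
  refine ⟨fun i => (hH.eigenvectorBasis i).ofLp, hH.eigenvalues,
    hH.mulVec_eigenvectorBasis, fun i => ?_, fun z => ?_⟩
  · have h := hH.eigenvectorBasis.orthonormal.1 i
    have h2 : inner ℝ (hH.eigenvectorBasis i) (hH.eigenvectorBasis i) = (1 : ℝ) := by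
      rw [real_inner_self_eq_norm_sq, h, one_pow]
    rw [EuclideanSpace.inner_eq_star_dotProduct] at h2
    simpa using h2
  · have h := hH.eigenvectorBasis.sum_inner_mul_inner (WithLp.toLp 2 z) (WithLp.toLp 2 (B *ᵥ z))
    simp only [EuclideanSpace.inner_eq_star_dotProduct, star_trivial] at h
    rw [dotProduct_comm, ← h]
    refine Finset.sum_congr rfl fun i _ => ?_
    have h3 : B *ᵥ z ⬝ᵥ (hH.eigenvectorBasis i).ofLp
        = hH.eigenvalues i * (z ⬝ᵥ (hH.eigenvectorBasis i).ofLp) := by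
      rw [dotProduct_comm, dotProduct_mulVec, ← mulVec_transpose, hB.eq,
        hH.mulVec_eigenvectorBasis, smul_dotProduct, smul_eq_mul, dotProduct_comm]
    rw [h3, dotProduct_comm z]
    ring

open Matrix in
/-- If a nonnegative symmetric matrix `Q` with positive weights `w` satisfies the Bochner-type
inequality `⟨x, Q x⟩ ≤ ∑ e, w e * (Q x) e ^ 2 / (Q w) e`, and any two vertices of its support are
joined by a path of length two, then `Q` is negative semidefinite on the `Q`-orthogonal
complement of `w`. -/
theorem quadraticForm_nonpos_of_bochner {ι : Type*} [Fintype ι] {Q : Matrix ι ι ℝ}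
    (hQ : Q.IsSymm) (hnn : ∀ e f, 0 ≤ Q e f) {w : ι → ℝ} (hw : ∀ e, 0 < w e)
    (hB : ∀ x : ι → ℝ, x ⬝ᵥ Q *ᵥ x ≤ ∑ e, w e * (Q *ᵥ x) e ^ 2 / (Q *ᵥ w) e)
    (hconn : ∀ e f, 0 < (Q *ᵥ w) e → 0 < (Q *ᵥ w) f → ∃ g, 0 < Q e g ∧ 0 < Q g f)
    {x : ι → ℝ} (hx : x ⬝ᵥ Q *ᵥ w = 0) : x ⬝ᵥ Q *ᵥ x ≤ 0 := by
  set r := Q *ᵥ w with hr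
  have hr0 : ∀ e, 0 ≤ r e := fun e =>
    Finset.sum_nonneg fun f _ => mul_nonneg (hnn e f) (hw f).le
  have hQr : ∀ e f, r e = 0 → Q e f = 0 := by
    intro e f h
    have h1 := (Finset.sum_eq_zero_iff_of_nonneg
      (fun f _ => mul_nonneg (hnn e f) (hw f).le)).1 h f (mem_univ f)
    exact (mul_eq_zero.1 h1).resolve_right (hw f).ne'
  have hQs : ∀ e f, Q e f = Q f e := fun e f => (hQ.apply e f).symm
  obtain ⟨a, ha, hwa⟩ : ∃ a : ι → ℝ, (∀ e, 0 < a e) ∧ ∀ e, w e = a e ^ 2 :=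
    ⟨fun e => Real.sqrt (w e), fun e => Real.sqrt_pos.2 (hw e),
      fun e => (Real.sq_sqrt (hw e).le).symm⟩
  obtain ⟨b, hb, hrb⟩ : ∃ b : ι → ℝ, (∀ e, 0 ≤ b e) ∧ ∀ e, r e = b e ^ 2 :=
    ⟨fun e => Real.sqrt (r e), fun e => Real.sqrt_nonneg _,
      fun e => (Real.sq_sqrt (hr0 e)).symm⟩
  set s : ι → ℝ := fun e => a e / b e with hs
  set B : Matrix ι ι ℝ := fun e f => s e * Q e f * s f with hBdef
  have hBs : B.IsSymm := by
    ext e f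
    change s f * Q f e * s e = s e * Q e f * s f
    rw [hQs e f]; ring
  have hBv : ∀ v : ι → ℝ, ∀ e, (B *ᵥ v) e = s e * (Q *ᵥ (fun f => s f * v f)) e := by
    intro v e
    simp only [mulVec, dotProduct, hBdef, Finset.mul_sum]
    exact Finset.sum_congr rfl fun f _ => by ring
  have hBq : ∀ v : ι → ℝ, v ⬝ᵥ B *ᵥ v = (fun f => s f * v f) ⬝ᵥ Q *ᵥ (fun f => s f * v f) := by
    intro v
    simp only [dotProduct, hBv]
    exact Finset.sum_congr rfl fun f _ => by simp only [mulVec, dotProduct]; ring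
  obtain ⟨v, μ, hv, hv1, hspec⟩ := exists_eigenvectors_quadraticForm hBs
  have key : ∀ i, 0 < μ i → ∃ c : ℝ, ∀ e, v i e = c * (a e * b e) := by
    intro i hμ
    set y : ι → ℝ := fun f => s f * v i f with hy
    have hyv : ∀ e, s e * (Q *ᵥ y) e = μ i * v i e := by
      intro e
      rw [← hBv, hv]; rfl
    have hyy : y ⬝ᵥ Q *ᵥ y = μ i := by
      rw [← hBq, hv, dotProduct_smul, hv1, smul_eq_mul, mul_one]
    have hvz : ∀ e, b e = 0 → v i e = 0 := by
      intro e he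
      have := hyv e
      simp only [hs, he, div_zero, zero_mul] at this
      exact (mul_eq_zero.1 this.symm).resolve_left hμ.ne'
    have h1 : μ i ≤ μ i ^ 2 := by
      have h2 := hB y
      rw [hyy] at h2
      refine h2.trans (le_of_eq ?_)
      calc ∑ e, w e * (Q *ᵥ y) e ^ 2 / r e = ∑ e, μ i ^ 2 * (v i e * v i e) := by
            refine Finset.sum_congr rfl fun e _ => ?_
            have h3 : w e * (Q *ᵥ y) e ^ 2 / r e = (s e * (Q *ᵥ y) e) ^ 2 := by
              rw [hwa, hrb, hs, mul_pow, div_pow]; ring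
            rw [h3, hyv]; ring
        _ = μ i ^ 2 := by
            rw [← Finset.mul_sum]
            have := hv1 i
            rw [dotProduct] at this
            rw [this, mul_one]
    have hμ1 : 1 ≤ μ i := by nlinarith
    have hle : ∑ e, r e * y e ^ 2 / w e ≤ 1 := by
      rw [← hv1 i, dotProduct]
      refine Finset.sum_le_sum fun e _ => ?_
      by_cases he : b e = 0
      · rw [hrb, he]; simp [mul_self_nonneg]
      · have hae := (ha e).ne'
        apply le_of_eq
        simp only [hrb, hwa, hy, hs]
        field_simp
    have hlap : ∑ e, ∑ f, Q e f * w e * w f * (y e / w e - y f / w f) ^ 2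
        = 2 * ∑ e, r e * y e ^ 2 / w e - 2 * (y ⬝ᵥ Q *ᵥ y) := by
      have e1 : ∀ e f, Q e f * w e * w f * (y e / w e - y f / w f) ^ 2
          = Q e f * w f * (y e ^ 2 / w e) + Q f e * w e * (y f ^ 2 / w f)
            - 2 * (y e * (Q e f * y f)) := by
        intro e f
        have h1 := (hw e).ne'
        have h2 := (hw f).ne'
        rw [hQs f e]
        field_simp
        ring
      have e2 : ∑ e, ∑ f, Q e f * w f * (y e ^ 2 / w e) = ∑ e, r e * y e ^ 2 / w e := by
        refine Finset.sum_congr rfl fun e _ => ?_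
        rw [← Finset.sum_mul, mul_div_assoc]; rfl
      simp only [e1, Finset.sum_sub_distrib, Finset.sum_add_distrib]
      rw [Finset.sum_comm (f := fun e f => Q f e * w e * (y f ^ 2 / w f)), e2]
      simp only [dotProduct, mulVec, Finset.mul_sum]
      rw [← Finset.sum_add_distrib]
      congr 1
      exact Finset.sum_congr rfl fun e _ => by ring
    have hnnt : ∀ e f, 0 ≤ Q e f * w e * w f * (y e / w e - y f / w f) ^ 2 := fun e f =>
      mul_nonneg (mul_nonneg (mul_nonneg (hnn e f) (hw e).le) (hw f).le) (sq_nonneg _)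
    have hz : ∑ e, ∑ f, Q e f * w e * w f * (y e / w e - y f / w f) ^ 2 = 0 :=
      le_antisymm (by rw [hlap, hyy]; linarith)
        (Finset.sum_nonneg fun e _ => Finset.sum_nonneg fun f _ => hnnt e f)
    have hadj : ∀ e f, 0 < Q e f → y e / w e = y f / w f := by
      intro e f hef
      have h2 := (Finset.sum_eq_zero_iff_of_nonneg
        (fun e _ => Finset.sum_nonneg fun f _ => hnnt e f)).1 hz e (mem_univ e)
      have h3 := (Finset.sum_eq_zero_iff_of_nonneg (fun f _ => hnnt e f)).1 h2 f (mem_univ f)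
      have h4 := (mul_eq_zero.1 h3).resolve_left
        (mul_pos (mul_pos hef (hw e)) (hw f)).ne'
      exact sub_eq_zero.1 (pow_eq_zero_iff two_ne_zero |>.1 h4)
    by_cases hN : ∃ e₀, 0 < r e₀
    · obtain ⟨e₀, he₀⟩ := hN
      refine ⟨y e₀ / w e₀, fun e => ?_⟩
      by_cases he : b e = 0
      · rw [hvz e he, he]; ring
      · have hre : 0 < r e := by rw [hrb]; positivity
        obtain ⟨g, hg1, hg2⟩ := hconn e₀ e he₀ hre
        rw [hadj _ _ hg1, hadj _ _ hg2]
        have hae := (ha e).ne'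
        simp only [hwa, hy, hs]
        field_simp
    · push Not at hN
      refine ⟨0, fun e => ?_⟩
      rw [hvz e, zero_mul]
      have := le_antisymm (hN e) (hr0 e)
      rw [hrb] at this
      exact pow_eq_zero_iff two_ne_zero |>.1 this
  set z : ι → ℝ := fun e => x e * b e / a e with hz
  have hzx : x ⬝ᵥ Q *ᵥ x = z ⬝ᵥ B *ᵥ z := by
    simp only [dotProduct, mulVec, Finset.mul_sum]
    refine Finset.sum_congr rfl fun e _ => Finset.sum_congr rfl fun f _ => ?_
    by_cases he : b e = 0
    · have : Q e f = 0 := hQr e f (by rw [hrb, he]; ring)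
      simp [hBdef, this]
    by_cases hf : b f = 0
    · have : Q e f = 0 := by rw [hQs]; exact hQr f e (by rw [hrb, hf]; ring)
      simp [hBdef, this]
    have h1 := (ha e).ne'
    have h2 := (ha f).ne'
    simp only [hz, hBdef, hs]
    field_simp
  rw [hzx, hspec]
  refine Finset.sum_nonpos fun i _ => ?_
  by_cases hμ : 0 < μ i
  · obtain ⟨c, hc⟩ := key i hμ
    have : z ⬝ᵥ v i = c * (x ⬝ᵥ r) := by
      simp only [dotProduct, Finset.mul_sum]
      refine Finset.sum_congr rfl fun e _ => ?_
      have h1 := (ha e).ne'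
      rw [hc, hrb]
      simp only [hz]
      field_simp
    rw [this, hx]; simp
  · exact mul_nonpos_of_nonpos_of_nonneg (not_lt.1 hμ) (sq_nonneg _)

/-- The list `l` has no repetitions and its entries form an independent set of `M`. -/
def IndepList {α : Type*} (M : Matroid α) (l : List α) : Prop :=
  l.Nodup ∧ M.Indep {e | e ∈ l}

/-- The sum over all ways of prepending `m` elements to `l` so that the result is independent,
each weighted by the product of the weights of the new elements. -/
noncomputable def extSum {α : Type*} [Fintype α] (M : Matroid α) (w : α → ℝ) : ℕ → List α → ℝ
  | 0, l => if IndepList M l then 1 else 0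
  | m + 1, l => ∑ e, w e * extSum M w m (e :: l)

/-- The matrix `(e, f) ↦ extSum M w m (e :: f :: l)`, a multiple of the Hessian of
`w ↦ extSum M w (m + 2) l`. -/
noncomputable def extHessian {α : Type*} [Fintype α] (M : Matroid α) (w : α → ℝ) (m : ℕ)
    (l : List α) : Matrix α α ℝ :=
  fun e f => extSum M w m (e :: f :: l)

section ExtSum

variable {α : Type*} {M : Matroid α}

theorem indepList_perm {l l' : List α} (h : l.Perm l') : IndepList M l ↔ IndepList M l' := by
  simp only [IndepList, h.nodup_iff, h.mem_iff]

theorem IndepList.of_cons {e : α} {l : List α} (h : IndepList M (e :: l)) : IndepList M l :=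
  ⟨(List.nodup_cons.1 h.1).2, h.2.subset fun _ hx => List.mem_cons_of_mem _ hx⟩

theorem setOf_mem_cons_eq (e : α) (l : List α) :
    {x | x ∈ e :: l} = insert e {x | x ∈ l} := by
  ext x; simp

theorem IndepList.cons_iff (hE : M.E = Set.univ) {l : List α} (h : IndepList M l) {e : α} :
    IndepList M (e :: l) ↔ e ∉ M.closure {x | x ∈ l} := by
  rw [IndepList, List.nodup_cons, setOf_mem_cons_eq, h.2.insert_indep_iff, hE]
  have hsub : {x | x ∈ l} ⊆ M.closure {x | x ∈ l} :=
    M.subset_closure _ (by rw [hE]; exact Set.subset_univ _)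
  constructor
  · rintro ⟨⟨h1, _⟩, h2 | h2⟩
    · exact h2.2
    · exact absurd h2 h1
  · intro h1
    exact ⟨⟨fun h2 => h1 (hsub h2), h.1⟩, Or.inl ⟨Set.mem_univ _, h1⟩⟩

theorem exists_notMem_closure_of_length_lt (hE : M.E = Set.univ) {J : Finset α}
    (hJ : M.Indep (J : Set α)) {l : List α} (hl : l.length < J.card) :
    ∃ g, g ∉ M.closure {x | x ∈ l} := by
  by_contra! hcon
  obtain ⟨I, hI⟩ := M.exists_isBasis {x | x ∈ l} (by rw [hE]; exact Set.subset_univ _)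
  have hIl : I.encard ≤ l.length := by
    have h1 : {x | x ∈ l} = (l.toFinset : Set α) := by ext; simp
    calc I.encard ≤ (l.toFinset : Set α).encard := Set.encard_le_encard (h1 ▸ hI.subset)
      _ = l.toFinset.card := Set.encard_coe_eq_coe_finsetCard _
      _ ≤ l.length := by exact_mod_cast l.toFinset_card_le
  obtain ⟨g, hg, hgI⟩ := hI.indep.augment hJ (by
    rw [Set.encard_coe_eq_coe_finsetCard]
    exact lt_of_le_of_lt hIl (by exact_mod_cast hl))
  have h2 := hcon g
  rw [← hI.closure_eq_closure, hI.indep.mem_closure_iff] at h2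
  rcases h2 with h2 | h2
  · exact h2.not_indep hgI
  · exact hg.2 h2

variable [Fintype α] {w : α → ℝ}

theorem extSum_perm (m : ℕ) {l l' : List α} (h : l.Perm l') :
    extSum M w m l = extSum M w m l' := by
  induction m generalizing l l' with
  | zero => simp only [extSum, indepList_perm h]
  | succ m ih => simp only [extSum, fun e => ih (h.cons e)]

theorem extSum_nonneg (hw : ∀ e, 0 ≤ w e) (m : ℕ) (l : List α) : 0 ≤ extSum M w m l := by
  induction m generalizing l with
  | zero => rw [extSum]; split_ifs <;> norm_num
  | succ m ih => exact Finset.sum_nonneg fun e _ => mul_nonneg (hw e) (ih _)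

theorem extSum_eq_zero (m : ℕ) {l : List α} (h : ¬ IndepList M l) : extSum M w m l = 0 := by
  induction m generalizing l with
  | zero => rw [extSum, if_neg h]
  | succ m ih =>
    exact Finset.sum_eq_zero fun e _ => by rw [ih fun h' => h h'.of_cons, mul_zero]

theorem extSum_pos (hE : M.E = Set.univ) {J : Finset α} (hJ : M.Indep (J : Set α))
    (hw : ∀ e, 0 < w e) (m : ℕ) {l : List α} (hl : IndepList M l)
    (hlen : l.length + m ≤ J.card) : 0 < extSum M w m l := by
  induction m generalizing l with
  | zero => rw [extSum, if_pos hl]; exact one_pos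
  | succ m ih =>
    obtain ⟨g, hg⟩ := exists_notMem_closure_of_length_lt hE hJ (l := l) (by omega)
    refine Finset.sum_pos' (fun e _ => mul_nonneg (hw e).le (extSum_nonneg (fun e => (hw e).le) _ _))
      ⟨g, mem_univ g, mul_pos (hw g) (ih ((hl.cons_iff hE).2 hg) ?_)⟩
    rw [List.length_cons]; omega

open Matrix

theorem extHessian_isSymm (m : ℕ) (l : List α) : (extHessian M w m l).IsSymm := by
  ext e f
  exact extSum_perm m (List.Perm.swap e f l)

theorem extHessian_mulVec_self (m : ℕ) (l : List α) (e : α) :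
    (extHessian M w m l *ᵥ w) e = extSum M w (m + 1) (e :: l) := by
  simp only [mulVec, dotProduct, extHessian, extSum]
  exact Finset.sum_congr rfl fun f _ => by rw [extSum_perm m (List.Perm.swap f e l), mul_comm]

theorem dotProduct_extHessian_comm (m : ℕ) (l : List α) (x y : α → ℝ) :
    x ⬝ᵥ extHessian M w m l *ᵥ y = y ⬝ᵥ extHessian M w m l *ᵥ x := by
  rw [dotProduct_mulVec, ← mulVec_transpose, (extHessian_isSymm m l).eq, dotProduct_comm]

theorem extHessian_succ (m : ℕ) (l : List α) (e f : α) :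
    extHessian M w (m + 1) l e f = ∑ g, w g * extHessian M w m (g :: l) e f := by
  simp only [extHessian, extSum]
  refine Finset.sum_congr rfl fun g _ => ?_
  have h : (e :: f :: g :: l).Perm (g :: e :: f :: l) := List.perm_middle (l₁ := [e, f])
  rw [extSum_perm m h]

theorem extHessian_succ_mulVec (m : ℕ) (l : List α) (x : α → ℝ) (e : α) :
    (extHessian M w (m + 1) l *ᵥ x) e = w ⬝ᵥ extHessian M w m (e :: l) *ᵥ x := by
  rw [dotProduct_extHessian_comm]
  refine Finset.sum_congr rfl fun f _ => ?_
  rw [extHessian_mulVec_self, mul_comm, extSum_perm (m + 1) (List.Perm.swap e f l)]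
  rfl

theorem dotProduct_extHessian_succ (m : ℕ) (l : List α) (x : α → ℝ) :
    x ⬝ᵥ extHessian M w (m + 1) l *ᵥ x =
      ∑ g, w g * (x ⬝ᵥ extHessian M w m (g :: l) *ᵥ x) := by
  simp only [dotProduct, mulVec, extHessian_succ, Finset.mul_sum, Finset.sum_mul]
  symm
  rw [Finset.sum_comm]
  refine Finset.sum_congr rfl fun e _ => ?_
  rw [Finset.sum_comm]
  exact Finset.sum_congr rfl fun g _ => Finset.sum_congr rfl fun f _ => by ring

/-- A quadratic form that is negative semidefinite on the orthogonal complement of `w` satisfies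
the reversed Cauchy-Schwarz inequality with `w`. -/
theorem extHessian_reverse_cauchySchwarz {m : ℕ} {l : List α}
    (h : ∀ x, x ⬝ᵥ extHessian M w m l *ᵥ w = 0 → x ⬝ᵥ extHessian M w m l *ᵥ x ≤ 0)
    (hpos : 0 < w ⬝ᵥ extHessian M w m l *ᵥ w) (x : α → ℝ) :
    (x ⬝ᵥ extHessian M w m l *ᵥ x) * (w ⬝ᵥ extHessian M w m l *ᵥ w)
      ≤ (x ⬝ᵥ extHessian M w m l *ᵥ w) ^ 2 := by
  set c := (x ⬝ᵥ extHessian M w m l *ᵥ w) / (w ⬝ᵥ extHessian M w m l *ᵥ w) with hc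
  have hcw : c * (w ⬝ᵥ extHessian M w m l *ᵥ w) = x ⬝ᵥ extHessian M w m l *ᵥ w :=
    div_mul_cancel₀ _ hpos.ne'
  have h1 := h (x - c • w) (by
    rw [sub_dotProduct, smul_dotProduct, smul_eq_mul, hcw, sub_self])
  rw [mulVec_sub, mulVec_smul, sub_dotProduct, dotProduct_sub, dotProduct_sub, smul_dotProduct,
    smul_dotProduct, dotProduct_smul, dotProduct_smul,
    dotProduct_extHessian_comm m l w x] at h1
  simp only [smul_eq_mul] at h1
  rw [hcw] at h1
  have h2 := mul_le_mul_of_nonneg_right h1 hpos.le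
  rw [sub_self, sub_zero, zero_mul, sub_mul, mul_right_comm, hcw, ← sq] at h2
  linarith

theorem extHessian_zero_nonpos (hE : M.E = Set.univ) (hw : ∀ e, 0 < w e) (l : List α)
    {x : α → ℝ} (hx : x ⬝ᵥ extHessian M w 0 l *ᵥ w = 0) :
    x ⬝ᵥ extHessian M w 0 l *ᵥ x ≤ 0 := by
  by_cases hl : IndepList M l
  swap
  · refine le_of_eq (Finset.sum_eq_zero fun e _ => mul_eq_zero_of_right _
      (Finset.sum_eq_zero fun f _ => mul_eq_zero_of_left
      (extSum_eq_zero 0 fun h => hl h.of_cons.of_cons) _))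
  set N : Finset α := univ.filter fun e => IndepList M (e :: l) with hN
  set κ : α → Set α := fun e => M.closure {x | x ∈ e :: l} with hκ
  have hent : ∀ e f, extHessian M w 0 l e f =
      (if e ∈ N then 1 else 0) * (if f ∈ N then 1 else 0)
        - ∑ c, (if e ∈ N ∧ κ e = c then 1 else 0) * (if f ∈ N ∧ κ f = c then 1 else 0) := by
    intro e f
    have hiff : IndepList M (e :: f :: l) ↔ e ∈ N ∧ f ∈ N ∧ κ e ≠ κ f := by
      simp only [hN, mem_filter, mem_univ, true_and]
      constructor
      · intro h
        have hf := h.of_cons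
        have he := ((indepList_perm (List.Perm.swap f e l)).1 h).of_cons
        refine ⟨he, hf, fun hk => ?_⟩
        refine (hf.cons_iff hE).1 h ?_
        change e ∈ κ f
        rw [← hk]
        exact M.subset_closure _ (by rw [hE]; exact Set.subset_univ _) (by simp)
      · rintro ⟨he, hf, hk⟩
        rw [hf.cons_iff hE]
        intro hmem
        refine hk ?_
        simp only [hκ, setOf_mem_cons_eq] at hmem ⊢
        exact Matroid.closure_insert_congr ⟨hmem, (hl.cons_iff hE).1 he⟩
    simp only [extHessian, extSum, hiff]
    by_cases he : e ∈ N <;> by_cases hf : f ∈ N <;> simp [he, hf]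
    by_cases hk : κ e = κ f
    · simp [hk]
    · simp [hk]
  have hform : ∀ y z : α → ℝ, y ⬝ᵥ extHessian M w 0 l *ᵥ z =
      (∑ e ∈ N, y e) * (∑ e ∈ N, z e)
        - ∑ c, (∑ e, if e ∈ N ∧ κ e = c then y e else 0)
          * (∑ e, if e ∈ N ∧ κ e = c then z e else 0) := by
    intro y z
    have hN1 : ∀ v : α → ℝ, ∑ e ∈ N, v e = ∑ e, (if e ∈ N then 1 else 0) * v e := fun v => by
      simp
    have hc1 : ∀ (v : α → ℝ) (c : Set α), (∑ e, if e ∈ N ∧ κ e = c then v e else 0) =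
        ∑ e, (if e ∈ N ∧ κ e = c then 1 else 0) * v e := fun v c => by
      simp
    simp only [hN1, hc1, Finset.sum_mul_sum]
    rw [Finset.sum_comm (s := univ) (t := univ) (f := fun c e => ∑ f, _),
      ← Finset.sum_sub_distrib]
    refine Finset.sum_congr rfl fun e _ => ?_
    rw [Finset.sum_comm, ← Finset.sum_sub_distrib, mulVec, dotProduct, Finset.mul_sum]
    refine Finset.sum_congr rfl fun f _ => ?_
    rw [hent, sub_mul, mul_sub, Finset.sum_mul, Finset.mul_sum]
    congr 1
    · ring
    · exact Finset.sum_congr rfl fun c _ => by ring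
  rw [hform] at hx ⊢
  set X : Set α → ℝ := fun c => ∑ e, if e ∈ N ∧ κ e = c then x e else 0
  set W : Set α → ℝ := fun c => ∑ e, if e ∈ N ∧ κ e = c then w e else 0 with hW
  have hcs := Finset.sum_mul_sq_le_sq_mul_sq univ X W
  have hww := hform w w
  have hnn : 0 ≤ w ⬝ᵥ extHessian M w 0 l *ᵥ w :=
    Finset.sum_nonneg fun e _ => mul_nonneg (hw e).le <| Finset.sum_nonneg fun f _ =>
      mul_nonneg (extSum_nonneg (fun e => (hw e).le) _ _) (hw f).le
  rw [hww] at hnn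
  rcases N.eq_empty_or_nonempty with hNe | hNe
  · rw [hNe, sum_empty, zero_mul, zero_sub]
    exact neg_nonpos.2 (Finset.sum_nonneg fun c _ => mul_self_nonneg _)
  · have hLw : 0 < ∑ e ∈ N, w e := Finset.sum_pos (fun e _ => hw e) hNe
    have hXX : ∑ c, X c * X c = ∑ c, X c ^ 2 := Finset.sum_congr rfl fun c _ => (sq _).symm
    have hWW : ∑ c, W c * W c = ∑ c, W c ^ 2 := Finset.sum_congr rfl fun c _ => (sq _).symm
    change _ - ∑ c, X c * X c ≤ 0
    change _ - ∑ c, X c * W c = 0 at hx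
    change 0 ≤ _ - ∑ c, W c * W c at hnn
    rw [hXX]
    rw [hWW] at hnn
    rw [← sub_eq_zero.1 hx] at hcs
    have hX0 : 0 ≤ ∑ c, X c ^ 2 := Finset.sum_nonneg fun c _ => sq_nonneg _
    have h3 : (∑ e ∈ N, x e) ^ 2 * (∑ e ∈ N, w e) ^ 2 ≤ (∑ c, X c ^ 2) * (∑ e ∈ N, w e) ^ 2 := by
      nlinarith [mul_le_mul_of_nonneg_left (sub_nonneg.1 hnn) hX0]
    have h4 := le_of_mul_le_mul_right h3 (by positivity)
    linarith [sq (∑ e ∈ N, x e)]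

theorem extHessian_nonpos (hE : M.E = Set.univ) {J : Finset α} (hJ : M.Indep (J : Set α))
    (hw : ∀ e, 0 < w e) (m : ℕ) {l : List α} (hlen : l.length + m + 2 ≤ J.card)
    {x : α → ℝ} (hx : x ⬝ᵥ extHessian M w m l *ᵥ w = 0) :
    x ⬝ᵥ extHessian M w m l *ᵥ x ≤ 0 := by
  have hw0 : ∀ e, 0 ≤ w e := fun e => (hw e).le
  induction m generalizing l x with
  | zero => exact extHessian_zero_nonpos hE hw l hx
  | succ m ih =>
    refine quadraticForm_nonpos_of_bochner (extHessian_isSymm _ _)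
      (fun e f => extSum_nonneg hw0 _ _) hw (fun y => ?_) (fun e f he hf => ?_) hx
    · rw [dotProduct_extHessian_succ]
      refine Finset.sum_le_sum fun g _ => ?_
      rw [mul_div_assoc]
      refine mul_le_mul_of_nonneg_left ?_ (hw0 g)
      rw [extHessian_succ_mulVec, extHessian_succ_mulVec]
      have hih : ∀ y, y ⬝ᵥ extHessian M w m (g :: l) *ᵥ w = 0 →
          y ⬝ᵥ extHessian M w m (g :: l) *ᵥ y ≤ 0 := fun y hy =>
        ih (by rw [List.length_cons]; omega) hy
      have hnn : ∀ e f, 0 ≤ extHessian M w m (g :: l) e f := fun e f => extSum_nonneg hw0 _ _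
      have hww : 0 ≤ w ⬝ᵥ extHessian M w m (g :: l) *ᵥ w :=
        Finset.sum_nonneg fun e _ => mul_nonneg (hw0 e) <| Finset.sum_nonneg fun f _ =>
          mul_nonneg (hnn e f) (hw0 f)
      rcases hww.eq_or_lt with h0 | hpos
      · rw [← h0, div_zero]
        apply hih
        refine Finset.sum_eq_zero fun e _ => mul_eq_zero_of_right _ ?_
        have h1 := (Finset.sum_eq_zero_iff_of_nonneg (fun e _ => mul_nonneg (hw0 e) <|
          Finset.sum_nonneg fun f _ => mul_nonneg (hnn e f) (hw0 f))).1 h0.symm e (mem_univ e)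
        exact (mul_eq_zero.1 h1).resolve_left (hw e).ne'
      · rw [le_div_iff₀ hpos, dotProduct_extHessian_comm m _ w y]
        exact extHessian_reverse_cauchySchwarz hih hpos y
    · have hind : ∀ e, 0 < (extHessian M w (m + 1) l *ᵥ w) e → IndepList M (e :: l) := by
        intro e he
        by_contra hcon
        rw [extHessian_mulVec_self, extSum_eq_zero _ hcon] at he
        exact he.false
      obtain ⟨g, hg⟩ := exists_notMem_closure_of_length_lt hE hJ (l := e :: f :: l)
        (by simp only [List.length_cons]; omega)
      have hge : IndepList M (g :: e :: l) := ((hind e he).cons_iff hE).2 fun h =>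
        hg (M.closure_subset_closure (by intro x; simp; tauto) h)
      have hgf : IndepList M (g :: f :: l) := ((hind f hf).cons_iff hE).2 fun h =>
        hg (M.closure_subset_closure (by intro x; simp; tauto) h)
      exact ⟨g, extSum_pos hE hJ hw _ ((indepList_perm (List.Perm.swap e g l)).1 hge)
        (by simp only [List.length_cons]; omega), extSum_pos hE hJ hw _ hgf
        (by simp only [List.length_cons]; omega)⟩

end ExtSum

section Segment

variable {α : Type*} [Fintype α] {M : Matroid α}

/-- Double counting of pairs `(S, e)` with `e ∈ S` and `|S| = m + 1`. -/
theorem sum_powersetCard_succ_mul_card (m : ℕ) (φ : Finset α → ℝ) :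
    (m + 1 : ℝ) * ∑ S ∈ Finset.univ.powersetCard (m + 1), φ S =
      ∑ e, ∑ S ∈ Finset.univ.powersetCard m, if e ∈ S then 0 else φ (insert e S) := by
  have h1 : (m + 1 : ℝ) * ∑ S ∈ Finset.univ.powersetCard (m + 1), φ S =
      ∑ S ∈ Finset.univ.powersetCard (m + 1), ∑ e, if e ∈ S then φ S else 0 := by
    rw [Finset.mul_sum]
    refine Finset.sum_congr rfl fun S hS => ?_
    rw [Finset.sum_ite_mem, univ_inter, Finset.sum_const, (mem_powersetCard.1 hS).2]
    simp
  rw [h1, Finset.sum_comm]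
  refine Finset.sum_congr rfl fun e _ => ?_
  have h2 : ∑ S ∈ Finset.univ.powersetCard m, (if e ∈ S then 0 else φ (insert e S)) =
      ∑ S ∈ Finset.univ.powersetCard m, (if e ∉ S then φ (insert e S) else 0) :=
    Finset.sum_congr rfl fun S _ => by simp only [ite_not]
  rw [h2, ← Finset.sum_filter, ← Finset.sum_filter]
  refine Finset.sum_nbij' (fun S => S.erase e) (fun S => insert e S) ?_ ?_ ?_ ?_ ?_
  · intro S hS
    simp only [mem_filter, mem_powersetCard_univ] at hS ⊢
    exact ⟨by rw [card_erase_of_mem hS.2, hS.1]; rfl, notMem_erase e S⟩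
  · intro S hS
    simp only [mem_filter, mem_powersetCard_univ] at hS ⊢
    exact ⟨by rw [card_insert_of_notMem hS.2, hS.1], mem_insert_self e S⟩
  · intro S hS
    exact insert_erase (mem_filter.1 hS).2
  · intro S hS
    exact erase_insert (mem_filter.1 hS).2
  · intro S hS
    rw [insert_erase (mem_filter.1 hS).2]

theorem extSum_eq_factorial_mul_sum (p : α → ℝ) (m : ℕ) (l : List α) :
    extSum M p m l = (m.factorial : ℝ) * ∑ S ∈ Finset.univ.powersetCard m,
      if IndepList M (S.toList ++ l) then ∏ e ∈ S, p e else 0 := by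
  induction m generalizing l with
  | zero => simp [extSum]
  | succ m ih =>
    rw [Nat.factorial_succ, Nat.cast_mul, mul_comm ((m + 1 : ℕ) : ℝ), mul_assoc, Nat.cast_succ,
      sum_powersetCard_succ_mul_card, extSum, Finset.mul_sum]
    refine Finset.sum_congr rfl fun e _ => ?_
    rw [ih, mul_left_comm, Finset.mul_sum]
    congr 1
    refine Finset.sum_congr rfl fun S _ => ?_
    have hperm : (S.toList ++ e :: l).Perm (e :: (S.toList ++ l)) := List.perm_middle
    rw [indepList_perm hperm]
    by_cases he : e ∈ S
    · have : ¬ IndepList M (e :: (S.toList ++ l)) := fun h => by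
        have := (List.nodup_cons.1 h.1).1
        simp [he] at this
      rw [if_pos he, if_neg this, mul_zero]
    · have hperm' : ((insert e S).toList ++ l).Perm (e :: (S.toList ++ l)) :=
        (Finset.toList_insert he).append_right l
      rw [if_neg he, indepList_perm hperm', Finset.prod_insert he, mul_ite, mul_zero]

theorem indepProb_eq_extSum (K : ℕ) (p : α → ℝ) : indepProb M K p = extSum M p K [] := by
  rw [extSum_eq_factorial_mul_sum, indepProb]
  congr 1
  refine Finset.sum_congr rfl fun S _ => ?_
  have : IndepList M (S.toList ++ []) ↔ M.Indep (S : Set α) := by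
    simp [IndepList, S.nodup_toList]
  rw [if_congr this rfl rfl]

theorem hasDerivAt_extSum (u x : α → ℝ) (m : ℕ) (l : List α) (t : ℝ) :
    HasDerivAt (fun t : ℝ => extSum M (fun e => u e + t * x e) (m + 1) l)
      ((m + 1) * ∑ e, x e * extSum M (fun e => u e + t * x e) m (e :: l)) t := by
  have hlin : ∀ e, HasDerivAt (fun t : ℝ => u e + t * x e) (x e) t := fun e => by
    simpa using ((hasDerivAt_id t).mul_const (x e)).const_add (u e)
  induction m generalizing l with
  | zero =>
    simp only [extSum]
    refine (HasDerivAt.fun_sum fun e _ => (hlin e).mul_const _).congr_deriv ?_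
    simp
  | succ m ih =>
    change HasDerivAt (fun t : ℝ => ∑ e, (u e + t * x e) *
      extSum M (fun e => u e + t * x e) (m + 1) (e :: l)) _ t
    refine (HasDerivAt.fun_sum fun e _ => (hlin e).mul (ih (e :: l))).congr_deriv ?_
    rw [Finset.sum_add_distrib]
    have h : ∑ e, (u e + t * x e) * ((m + 1 : ℝ) *
        ∑ f, x f * extSum M (fun e => u e + t * x e) m (f :: e :: l)) =
        (m + 1) * ∑ e, x e * extSum M (fun e => u e + t * x e) (m + 1) (e :: l) := by
      simp only [extSum, Finset.mul_sum]
      rw [Finset.sum_comm]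
      refine Finset.sum_congr rfl fun e _ => Finset.sum_congr rfl fun f _ => ?_
      rw [extSum_perm m (List.Perm.swap f e l)]
      ring
    rw [h]
    simp only [extSum]
    push_cast
    ring

open Matrix in
/-- Along a line through positive weights the function `extSum M _ K []` has the first and second
derivatives required for log-concavity. -/
theorem exists_hasDerivAt_extSum (hE : M.E = Set.univ) {J : Finset α}
    (hJ : M.Indep (J : Set α)) (hJ1 : 1 ≤ J.card) (u x : α → ℝ) :
    ∃ g' g'' : ℝ → ℝ,
      (∀ t, HasDerivAt (fun t => extSum M (fun e => u e + t * x e) J.card []) (g' t) t) ∧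
      (∀ t, HasDerivAt g' (g'' t) t) ∧
      ∀ t, (∀ e, 0 < u e + t * x e) →
        extSum M (fun e => u e + t * x e) J.card [] * g'' t ≤ g' t ^ 2 := by
  obtain ⟨k, hk⟩ : ∃ k, J.card = k + 1 := ⟨J.card - 1, by omega⟩
  rw [hk]
  rcases k with _ | m
  · refine ⟨_, fun _ => 0, fun t => hasDerivAt_extSum u x 0 [] t, fun t => ?_, fun t _ => ?_⟩
    · simp only [extSum]
      exact hasDerivAt_const _ _
    · rw [mul_zero]; exact sq_nonneg _
  · refine ⟨_, fun t => ((m + 1 : ℕ) + 1) * ∑ e, x e * ((m + 1) *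
      ∑ f, x f * extSum M (fun e => u e + t * x e) m (f :: e :: [])),
      fun t => hasDerivAt_extSum u x (m + 1) [] t, fun t => ?_, fun t ht => ?_⟩
    · exact (HasDerivAt.fun_sum fun e _ =>
        (hasDerivAt_extSum u x m [e] t).const_mul (x e)).const_mul _
    · set w : α → ℝ := fun e => u e + t * x e
      change ∀ e, 0 < w e at ht
      change extSum M w (m + 2) [] * (((m + 1 : ℕ) + 1) * ∑ e, x e * ((m + 1) *
        ∑ f, x f * extSum M w m [f, e])) ≤ _
      have h1 : ∑ e, x e * extSum M w (m + 1) [e] = x ⬝ᵥ extHessian M w m [] *ᵥ w :=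
        Finset.sum_congr rfl fun e _ => by rw [extHessian_mulVec_self]
      have h2 : extSum M w (m + 2) [] = w ⬝ᵥ extHessian M w m [] *ᵥ w :=
        Finset.sum_congr rfl fun e _ => by rw [extHessian_mulVec_self]
      have h3 : ∑ e, x e * ((m + 1 : ℝ) * ∑ f, x f * extSum M w m [f, e]) =
          (m + 1) * (x ⬝ᵥ extHessian M w m [] *ᵥ x) := by
        simp only [dotProduct, mulVec, Finset.mul_sum, extHessian]
        refine Finset.sum_congr rfl fun e _ => Finset.sum_congr rfl fun f _ => ?_
        rw [extSum_perm m (List.Perm.swap f e []).symm]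
        ring
      have hpos : 0 < extSum M w (m + 2) [] :=
        extSum_pos hE hJ ht _ ⟨List.nodup_nil, by simp⟩ (by simp [hk])
      have hcs := extHessian_reverse_cauchySchwarz (w := w) (fun y hy => extHessian_nonpos hE hJ ht m
        (l := []) (by simp [hk]) hy) (h2 ▸ hpos) x
      rw [h3, h1, h2]
      push_cast
      set q := x ⬝ᵥ extHessian M w m [] *ᵥ w
      have hm : (0 : ℝ) ≤ m := Nat.cast_nonneg m
      have h5 := mul_le_mul_of_nonneg_left hcs
        (mul_nonneg (by linarith : (0 : ℝ) ≤ m + 1 + 1) (by linarith : (0 : ℝ) ≤ m + 1))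
      nlinarith [mul_nonneg (by linarith : (0 : ℝ) ≤ m + 1 + 1) (sq_nonneg q)]

/-- Along a segment from a positive point to a simplex point with no smaller value of
`indepProb`, the value at the starting point is a lower bound. -/
theorem indepProb_le_of_segment (hE : M.E = Set.univ) {J : Finset α}
    (hJ : M.Indep (J : Set α)) (hJ1 : 1 ≤ J.card) {u p : α → ℝ} (hu : ∀ e, 0 < u e)
    (hp : ∀ e, 0 ≤ p e) (hle : indepProb M J.card u ≤ indepProb M J.card p)
    {t : ℝ} (ht0 : 0 ≤ t) (ht1 : t ≤ 1) :
    indepProb M J.card u ≤ indepProb M J.card (fun e => u e + t * (p e - u e)) := by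
  simp only [indepProb_eq_extSum] at hle ⊢
  obtain ⟨g', g'', hg', hg'', hineq⟩ :=
    exists_hasDerivAt_extSum hE hJ hJ1 u (fun e => p e - u e)
  set g : ℝ → ℝ := fun t => extSum M (fun e => u e + t * (p e - u e)) J.card [] with hg
  have hpos : ∀ s : ℝ, 0 ≤ s → s < 1 → ∀ e, 0 < u e + s * (p e - u e) := fun s h0 h1 e => by
    nlinarith [mul_pos (sub_pos.2 h1) (hu e), mul_nonneg h0 (hp e)]
  have hg0 : g 0 = extSum M u J.card [] := by simp [hg]
  have hg1 : g 1 = extSum M p J.card [] := by simp [hg]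
  have hgpos' : ∀ s : ℝ, 0 ≤ s → s < 1 → 0 < g s := fun s h0 h1 =>
    extSum_pos hE hJ (hpos s h0 h1) _ ⟨List.nodup_nil, by simp⟩ (by simp)
  have hgpos : ∀ s ∈ Set.Icc (0 : ℝ) 1, 0 < g s := by
    rintro s ⟨h0, h1⟩
    rcases h1.lt_or_eq with h1 | rfl
    · exact hgpos' s h0 h1
    · rw [hg1]
      refine lt_of_lt_of_le ?_ hle
      rw [← hg0]
      exact hgpos' 0 le_rfl one_pos
  have hconc : ConcaveOn ℝ (Set.Icc (0 : ℝ) 1) (fun s => Real.log (g s)) := by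
    refine concaveOn_of_hasDerivWithinAt2_nonpos (convex_Icc 0 1)
      (f' := fun s => g' s / g s) (f'' := fun s => (g'' s * g s - g' s * g' s) / g s ^ 2)
      ?_ ?_ ?_ ?_
    · exact fun s hs => ((hg' s).continuousAt.log (hgpos s hs).ne').continuousWithinAt
    · exact fun s hs => ((hg' s).log (hgpos s (interior_subset hs)).ne').hasDerivWithinAt
    · exact fun s hs =>
        ((hg'' s).div (hg' s) (hgpos s (interior_subset hs)).ne').hasDerivWithinAt
    · intro s hs
      rw [interior_Icc] at hs
      refine div_nonpos_of_nonpos_of_nonneg ?_ (sq_nonneg _)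
      have := hineq s (hpos s hs.1.le hs.2)
      rw [← sq, mul_comm]
      exact sub_nonpos.2 this
  have h0 : (0 : ℝ) ∈ Set.Icc (0 : ℝ) 1 := ⟨le_rfl, zero_le_one⟩
  have h1 : (1 : ℝ) ∈ Set.Icc (0 : ℝ) 1 := ⟨zero_le_one, le_rfl⟩
  have hmin := hconc.min_le_of_mem_Icc h0 h1 ⟨ht0, ht1⟩
  rw [min_eq_left (Real.log_le_log (hgpos 0 h0) (by rw [hg0, hg1]; exact hle))] at hmin
  have := (Real.log_le_log_iff (hgpos 0 h0) (hgpos t ⟨ht0, ht1⟩)).1 hmin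
  rwa [hg0] at this

theorem continuous_indepProb (K : ℕ) : Continuous (indepProb M K) := by
  unfold indepProb
  refine continuous_const.mul (continuous_finsetSum _ fun S _ => ?_)
  split_ifs
  · exact continuous_finsetProd _ fun e _ => continuous_apply e
  · exact continuous_const

end Segment

/-- **Local quadratic stability implies global quadratic stability.** For a transitive
matroid with `1 ≤ K ≤ rank M`, if the uniform distribution `u` satisfies a local
quadratic stability estimate on the simplex, then `u` is the unique maximizer of
`F_{M,K}` and a global quadratic stability estimate holds. -/
theorem local_to_global_quadratic_stability {α : Type*} [Fintype α] (M : Matroid α)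
    (hE : M.E = Set.univ) (K : ℕ) (hK : 1 ≤ K)
    (hrank : ∃ I : Finset α, M.Indep (I : Set α) ∧ I.card = K)
    (htrans : ∀ e e' : α, ∃ g : α ≃ α,
      (∀ S : Set α, M.Indep (g '' S) ↔ M.Indep S) ∧ g e = e')
    (u : α → ℝ) (hu : u = fun _ => (Fintype.card α : ℝ)⁻¹)
    (ε : ℝ) (hε : 0 < ε) (cloc : ℝ) (hcloc : 0 < cloc)
    (hlocal : ∀ p : α → ℝ, (∀ e, 0 ≤ p e) → (∑ e, p e = 1) →
      Real.sqrt (∑ e, (p e - u e) ^ 2) ≤ ε →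
      indepProb M K u - indepProb M K p ≥ cloc * ∑ e, (p e - u e) ^ 2) :
    (∀ p : α → ℝ, (∀ e, 0 ≤ p e) → (∑ e, p e = 1) → p ≠ u →
        indepProb M K p < indepProb M K u) ∧
    ∃ c > (0 : ℝ), ∀ p : α → ℝ, (∀ e, 0 ≤ p e) → (∑ e, p e = 1) →
        indepProb M K u - indepProb M K p ≥ c * ∑ e, (p e - u e) ^ 2 := by
  obtain ⟨J, hJ, rfl⟩ := hrank
  have hcard : 0 < Fintype.card α := lt_of_lt_of_le hK (Finset.card_le_univ J)
  have hu0 : ∀ e, 0 < u e := fun e => by rw [hu]; positivity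
  have hu1 : ∑ e, u e = 1 := by
    rw [hu, Finset.sum_const, Finset.card_univ, nsmul_eq_mul]
    exact mul_inv_cancel₀ (by positivity)
  have hmax : ∀ p : α → ℝ, (∀ e, 0 ≤ p e) → (∑ e, p e = 1) → p ≠ u →
      indepProb M J.card p < indepProb M J.card u := by
    intro p hp hp1 hne
    by_contra! hle
    have hd : 0 < ∑ e, (p e - u e) ^ 2 := by
      obtain ⟨e, he⟩ := Function.ne_iff.1 hne
      exact Finset.sum_pos' (fun e _ => sq_nonneg _)
        ⟨e, mem_univ e, by have := sub_ne_zero.2 he; positivity⟩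
    set d := Real.sqrt (∑ e, (p e - u e) ^ 2) with hd'
    have hd0 : 0 < d := Real.sqrt_pos.2 hd
    set t := min 1 (ε / d) with ht
    have ht0 : 0 < t := lt_min one_pos (div_pos hε hd0)
    have ht1 : t ≤ 1 := min_le_left _ _
    have hsum : ∑ e, (u e + t * (p e - u e) - u e) ^ 2 = t ^ 2 * ∑ e, (p e - u e) ^ 2 := by
      rw [Finset.mul_sum]
      exact Finset.sum_congr rfl fun e _ => by ring
    have h1 := hlocal (fun e => u e + t * (p e - u e))
      (fun e => by nlinarith [mul_nonneg (sub_nonneg.2 ht1) (hu0 e).le, mul_nonneg ht0.le (hp e)])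
      (by rw [Finset.sum_add_distrib, ← Finset.mul_sum, Finset.sum_sub_distrib, hp1, hu1]; ring)
      (by
        rw [hsum, Real.sqrt_mul (sq_nonneg t), Real.sqrt_sq ht0.le, ← hd', ← le_div_iff₀ hd0]
        exact min_le_right _ _)
    rw [hsum] at h1
    have h2 := indepProb_le_of_segment hE hJ hK hu0 hp hle ht0.le ht1
    have h3 : 0 < cloc * (t ^ 2 * ∑ e, (p e - u e) ^ 2) := by positivity
    linarith
  refine ⟨hmax, ?_⟩
  have hdist : Continuous fun p : α → ℝ => ∑ e, (p e - u e) ^ 2 := by fun_prop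
  set C : Set (α → ℝ) := stdSimplex ℝ α ∩ {p | ε ^ 2 ≤ ∑ e, (p e - u e) ^ 2} with hC
  have hCc : IsCompact C :=
    (isCompact_stdSimplex ℝ α).inter_right (isClosed_le continuous_const hdist)
  have hCpos : ∀ p ∈ C, 0 < ∑ e, (p e - u e) ^ 2 := fun p hp =>
    lt_of_lt_of_le (by positivity) hp.2
  have hfar : ∃ δ > (0 : ℝ), ∀ p ∈ C,
      δ * ∑ e, (p e - u e) ^ 2 ≤ indepProb M J.card u - indepProb M J.card p := by
    rcases C.eq_empty_or_nonempty with hCe | hCne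
    · exact ⟨1, one_pos, fun p hp => by rw [hCe] at hp; exact hp.elim⟩
    · obtain ⟨p₀, hp₀, hmin⟩ := hCc.exists_isMinOn hCne
        (f := fun p => (indepProb M J.card u - indepProb M J.card p) / ∑ e, (p e - u e) ^ 2)
        ((continuous_const.sub (continuous_indepProb _)).continuousOn.div hdist.continuousOn
          fun p hp => (hCpos p hp).ne')
      refine ⟨_, div_pos (sub_pos.2 (hmax p₀ hp₀.1.1 hp₀.1.2 ?_)) (hCpos p₀ hp₀),
        fun p hp => (le_div_iff₀ (hCpos p hp)).1 (hmin hp)⟩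
      rintro rfl
      simpa using hCpos _ hp₀
  obtain ⟨δ, hδ, hfar⟩ := hfar
  refine ⟨min cloc δ, lt_min hcloc hδ, fun p hp hp1 => ?_⟩
  have hnn : 0 ≤ ∑ e, (p e - u e) ^ 2 := Finset.sum_nonneg fun e _ => sq_nonneg _
  by_cases h : Real.sqrt (∑ e, (p e - u e) ^ 2) ≤ ε
  · exact (mul_le_mul_of_nonneg_right (min_le_left _ _) hnn).trans (hlocal p hp hp1 h)
  · have hpC : p ∈ C := ⟨⟨hp, hp1⟩, (Real.le_sqrt' hε).1 (not_le.1 h).le⟩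
    exact (mul_le_mul_of_nonneg_right (min_le_right _ _) hnn).trans (hfar p hpC)
end

section
/- Let q be a prime power, let N ≥ 1 and 1 ≤ K ≤ N, and let E = PG(N−1, q) denote the set of one-dimensional subspaces of 𝔽_q^N. For a probability distribution p on E, let F_K(p) = K! · Σ_S Π_{L ∈ S} p_L, where the sum is over all K-element subsets S of E such that choosing one nonzero representative vector from each line in S yields K linearly independent vectors in 𝔽_q^N (equivalently, the probability that K i.i.d. projective points drawn from p span a K-dimensional subspace, i.e., that the corresponding K×N matrix of representatives has full row rank). Then F_K(p) ≤ F_K(u) for every p, where u is the uniform distribution on E, with u_L = (q−1)/(q^N−1). -/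
open Finset Classical
open scoped LinearAlgebra.Projectivization

noncomputable instance projFintype (F : Type*) [Field F] [Fintype F] (N : ℕ) :
    Fintype (ℙ F (Fin N → F)) :=
  @Fintype.ofFinite _ (Quotient.finite _)

/-- A finset `S` of projective points is independent if nonzero representative vectors
of its lines are linearly independent. -/
def ProjIndep (F : Type*) [Field F] [Fintype F] (N : ℕ)
    (S : Finset (ℙ F (Fin N → F))) : Prop :=
  Projectivization.Independent (fun x : {x // x ∈ S} => (x : ℙ F (Fin N → F)))

/-- `F_K(p) = K! · ∑_{S independent, |S| = K} ∏_{L ∈ S} p_L`: the probability that `K`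
i.i.d. projective points drawn from `p` are linearly independent (equivalently, that
the corresponding `K × N` matrix of representatives has full row rank). -/
noncomputable def projProb (F : Type*) [Field F] [Fintype F] (N K : ℕ)
    (p : ℙ F (Fin N → F) → ℝ) : ℝ :=
  (K.factorial : ℝ) *
    ∑ S ∈ Finset.univ.powersetCard K, if ProjIndep F N S then ∏ L ∈ S, p L else 0

/-- Tangent line estimate for `b ↦ b ^ m - b ^ (m + 1)`: the remainder of the second order Taylor
expansion of `b ↦ b ^ m` is controlled. -/
theorem exists_pow_taylor_remainder (m : ℕ) {a b : ℝ} (ha0 : 0 ≤ a)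
    (hb : (m : ℝ) ≤ (m + 1) * b) :
    ∃ E : ℝ, 0 ≤ E ∧ a ^ (m + 1) = b ^ (m + 1) + (m + 1) * b ^ m * (a - b) + (a - b) ^ 2 * E ∧
      (1 - a) * E ≤ (m + 1) * b ^ m := by
  induction m with
  | zero => exact ⟨0, by simp⟩
  | succ m ih =>
    push_cast at hb ⊢
    have hb0 : 0 ≤ b := by
      by_contra! h
      nlinarith [(Nat.cast_nonneg m : (0 : ℝ) ≤ m)]
    have hm : (m : ℝ) + 1 ≤ (m + 1 + 1) * b := hb
    obtain ⟨E, hE, h1, h2⟩ := ih (by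
      by_contra! h
      nlinarith [(Nat.cast_nonneg m : (0 : ℝ) ≤ m)])
    have hbm : 0 ≤ b ^ m := pow_nonneg hb0 m
    refine ⟨a * E + (m + 1) * b ^ m, by positivity, ?_, ?_⟩
    · rw [pow_succ a (m + 1), h1]
      ring
    · have h3 : a * ((1 - a) * E) ≤ a * ((m + 1) * b ^ m) := mul_le_mul_of_nonneg_left h2 ha0
      have h4 : (m + 1) * b ^ m ≤ (m + 1 + 1) * b * b ^ m := mul_le_mul_of_nonneg_right hm hbm
      rw [pow_succ b m]
      nlinarith

theorem exists_slope_mul_sub_pow_le (m : ℕ) {u W : ℝ} (hu : (m + 1) * u ≤ 1) (hW : 0 ≤ W) :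
    ∃ D : ℝ, ∀ h : ℝ, 0 ≤ h → h ≤ W →
      h * (W - h) ^ m ≤ W ^ (m + 1) * (u * (1 - u) ^ m) + D * (h - W * u) := by
  have unit : ∃ D : ℝ, ∀ x : ℝ, 0 ≤ x → x ≤ 1 →
      x * (1 - x) ^ m ≤ u * (1 - u) ^ m + D * (x - u) := by
    cases m with
    | zero => exact ⟨1, fun x _ _ => by simp⟩
    | succ m =>
      refine ⟨(m + 2) * (1 - u) ^ (m + 1) - (m + 1) * (1 - u) ^ m, fun x hx0 hx1 => ?_⟩
      push_cast at hu
      obtain ⟨E, hE, h1, h2⟩ := exists_pow_taylor_remainder m (a := 1 - x) (b := 1 - u)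
        (by linarith) (by
          by_contra! h
          nlinarith [(Nat.cast_nonneg m : (0 : ℝ) ≤ m)])
      rw [h1]
      have h3 := mul_le_mul_of_nonneg_left h2 (sq_nonneg (1 - x - (1 - u)))
      rw [pow_succ (1 - u) m] at *
      nlinarith
  obtain ⟨D, hD⟩ := unit
  refine ⟨W ^ m * D, fun h h0 h1 => ?_⟩
  rcases hW.eq_or_lt with rfl | hW
  · obtain rfl : h = 0 := le_antisymm h1 h0
    simp
  · have key := hD (h / W) (by positivity) ((div_le_one hW).2 h1)
    have := mul_le_mul_of_nonneg_left key (by positivity : 0 ≤ W ^ (m + 1))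
    have e1 : W ^ (m + 1) * (h / W * (1 - h / W) ^ m) = h * (W - h) ^ m := by
      rw [show W - h = W * (1 - h / W) by field_simp, mul_pow, pow_succ]
      field_simp
    have e2 : W ^ (m + 1) * (D * (h / W - u)) = W ^ m * D * (h - W * u) := by
      rw [pow_succ]
      field_simp
    rw [e1, mul_add, e2] at this
    exact this

/-- Tuple sums against a pushed forward weight. -/
theorem sum_tuple_pushforward {A B : Type*} [Fintype A] [Fintype B] {K : ℕ} (φ : A → B)
    (R : (Fin K → B) → Prop) (w : A → ℝ) :
    ∑ v : Fin K → A, (if R (φ ∘ v) then ∏ i, w (v i) else 0) =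
      ∑ y : Fin K → B, if R y then ∏ i, ∑ a with φ a = y i, w a else 0 := by
  rw [← Finset.sum_fiberwise Finset.univ (fun v : Fin K → A => φ ∘ v)]
  refine Finset.sum_congr rfl fun y _ => ?_
  rw [Finset.prod_univ_sum]
  have hfib : Finset.univ.filter (fun v : Fin K → A => φ ∘ v = y) =
      Fintype.piFinset fun i => Finset.univ.filter fun a => φ a = y i := by
    ext v
    simp [funext_iff]
  rw [← hfib]
  split_ifs with hy
  · refine Finset.sum_congr rfl fun v hv => ?_
    rw [(Finset.mem_filter.1 hv).2, if_pos hy]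
  · refine Finset.sum_eq_zero fun v hv => ?_
    rw [(Finset.mem_filter.1 hv).2, if_neg hy]

/-- Sums over `K`-subsets as sums over injective `K`-tuples. -/
theorem factorial_mul_sum_powersetCard {A : Type*} [Fintype A] (K : ℕ) (g : Finset A → ℝ) :
    (K.factorial : ℝ) * ∑ S ∈ Finset.univ.powersetCard K, g S =
      ∑ f : Fin K → A, if Function.Injective f then g (Finset.univ.image f) else 0 := by
  rw [← Finset.sum_filter, Finset.mul_sum,
    ← Finset.sum_fiberwise_of_maps_to (t := Finset.univ.powersetCard K)
      (g := fun f : Fin K → A => Finset.univ.image f)]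
  · refine Finset.sum_congr rfl fun S hS => ?_
    have hS := (Finset.mem_powersetCard.1 hS).2
    rw [Finset.sum_congr rfl (g := fun _ => g S)
      (fun f hf => by rw [(Finset.mem_filter.1 hf).2]), Finset.sum_const, nsmul_eq_mul]
    congr 2
    rw [← Fintype.card_coe] at hS
    have e : {f : Fin K → A // Function.Injective f ∧ Finset.univ.image f = S} ≃ (Fin K ≃ S) :=
      { toFun := fun f => Equiv.ofBijective
          (fun i => ⟨f.1 i, f.2.2.subset (Finset.mem_image_of_mem _ (Finset.mem_univ i))⟩)
          ⟨fun i j hij => f.2.1 (congrArg Subtype.val hij), fun s => by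
            obtain ⟨i, _, hi⟩ := Finset.mem_image.1 (f.2.2.symm.subset s.2)
            exact ⟨i, Subtype.ext hi⟩⟩
        invFun := fun e => ⟨fun i => e i, Subtype.val_injective.comp e.injective, by
          ext a
          simp only [Finset.mem_image, Finset.mem_univ, true_and]
          exact ⟨fun ⟨i, hi⟩ => hi ▸ (e i).2, fun ha => ⟨e.symm ⟨a, ha⟩, by simp⟩⟩⟩
        left_inv := fun f => rfl
        right_inv := fun e => by ext; rfl }
    have hc := Fintype.card_congr e
    rw [Fintype.card_equiv ((Fintype.equivFinOfCardEq hS).symm), Fintype.card_fin,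
      Fintype.card_subtype] at hc
    rw [← hc, Finset.filter_filter]
  · intro f hf
    rw [Finset.mem_powersetCard]
    exact ⟨Finset.subset_univ _, by
      rw [Finset.card_image_of_injective _ (Finset.mem_filter.1 hf).2, Finset.card_univ,
        Fintype.card_fin]⟩

/-- A family with nonzero head is independent iff its tail is independent modulo the head. -/
theorem linearIndependent_cons_iff_mkQ {F V : Type*} [Field F] [AddCommGroup V] [Module F V]
    {K : ℕ} (x : V) (v : Fin K → V) :
    LinearIndependent F (Fin.cons x v : Fin (K + 1) → V) ↔
      x ≠ 0 ∧ LinearIndependent F ((Submodule.span F {x}).mkQ ∘ v) := by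
  constructor
  · intro h
    refine ⟨by simpa using h.ne_zero 0, ?_⟩
    rw [Fintype.linearIndependent_iff] at h ⊢
    intro g hg i
    simp only [Function.comp_apply, ← map_smul, ← map_sum] at hg
    rw [Submodule.mkQ_apply, Submodule.Quotient.mk_eq_zero, Submodule.mem_span_singleton] at hg
    obtain ⟨a, ha⟩ := hg
    have := h (Fin.cons (-a) g) (by simp [Fin.sum_univ_succ, ← ha]) i.succ
    simpa using this
  · rintro ⟨hx, h⟩
    rw [Fintype.linearIndependent_iff] at h ⊢
    intro g hg
    rw [Fin.sum_univ_succ] at hg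
    simp only [Fin.cons_zero, Fin.cons_succ] at hg
    have hx0 : (Submodule.span F {x}).mkQ x = 0 := by
      simp [Submodule.mem_span_singleton_self]
    have ht := h (fun i => g i.succ) (by
      have := congrArg (Submodule.span F {x}).mkQ hg
      simpa only [map_add, map_sum, map_smul, hx0, smul_zero, zero_add, map_zero,
        Function.comp_apply] using this)
    intro i
    refine Fin.cases ?_ ht i
    simpa [ht, hx] using hg

/-- The total weight of the linearly independent `K`-tuples of vectors. -/
noncomputable def indepTupleSum (F : Type*) {V : Type*} [Field F] [AddCommGroup V] [Module F V]
    [Fintype V] (K : ℕ) (w : V → ℝ) : ℝ :=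
  ∑ v : Fin K → V, if LinearIndependent F v then ∏ i, w (v i) else 0

theorem indepTupleSum_succ {F V : Type*} [Field F] [AddCommGroup V] [Module F V]
    [Fintype V] (K : ℕ) (w : V → ℝ) :
    indepTupleSum F (K + 1) w = ∑ x with x ≠ 0, w x *
      indepTupleSum F K (fun y : V ⧸ Submodule.span F {x} =>
        ∑ z with (Submodule.span F {x}).mkQ z = y, w z) := by
  unfold indepTupleSum
  rw [← (Fin.consEquiv fun _ => V).sum_comp, Fintype.sum_prod_type, Finset.sum_filter]
  refine Finset.sum_congr rfl fun x _ => ?_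
  rw [← sum_tuple_pushforward (Submodule.span F {x}).mkQ (fun y => LinearIndependent F y)]
  have hcons : ∀ v : Fin K → V, Fin.consEquiv (fun _ => V) (x, v) = Fin.cons x v := fun _ => rfl
  simp only [hcons, linearIndependent_cons_iff_mkQ, Fin.prod_univ_succ, Fin.cons_zero,
    Fin.cons_succ]
  split_ifs with hx
  · rw [Finset.mul_sum]
    exact Finset.sum_congr rfl fun v _ => by simp [hx]
  · simp [hx]

theorem sum_span_singleton {F V : Type*} [Field F] [Fintype F] [AddCommGroup V] [Module F V]
    [Fintype V] {w : V → ℝ} (hw : ∀ (c : F) (x : V), c ≠ 0 → w (c • x) = w x) {x : V}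
    (hx : x ≠ 0) :
    ∑ z with z ∈ Submodule.span F {x}, w z = w 0 + (Fintype.card F - 1) * w x := by
  have himg : Finset.univ.filter (fun z => z ∈ Submodule.span F {x}) =
      Finset.univ.image (fun c : F => c • x) := by
    ext z
    simp [Submodule.mem_span_singleton]
  rw [himg, Finset.sum_image fun c _ d _ h => smul_left_injective F hx h,
    ← Finset.add_sum_erase _ _ (Finset.mem_univ 0), zero_smul,
    Finset.sum_congr rfl fun c hc => hw c x (Finset.ne_of_mem_erase hc), Finset.sum_const,
    Finset.card_erase_of_mem (Finset.mem_univ 0), Finset.card_univ, nsmul_eq_mul,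
    Nat.cast_sub Fintype.card_pos, Nat.cast_one]

theorem sum_ne_zero_pushforward_mkQ {F V : Type*} [Field F] [Fintype F] [AddCommGroup V]
    [Module F V] [Fintype V] {w : V → ℝ}
    (hw : ∀ (c : F) (x : V), c ≠ 0 → w (c • x) = w x) {x : V} (hx : x ≠ 0) :
    ∑ y : V ⧸ Submodule.span F {x} with y ≠ 0,
        ∑ z with (Submodule.span F {x}).mkQ z = y, w z =
      ∑ z with z ≠ 0, w z - (Fintype.card F - 1) * w x := by
  have h1 := Finset.sum_fiberwise Finset.univ (Submodule.span F {x}).mkQ w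
  have h2 := sum_span_singleton hw hx
  rw [← Finset.add_sum_erase _ _ (Finset.mem_univ 0)] at h1
  simp only [Submodule.mkQ_apply, Submodule.Quotient.mk_eq_zero] at h1 ⊢
  rw [Finset.filter_ne', Finset.filter_ne']
  have h3 := Finset.add_sum_erase _ w (Finset.mem_univ 0)
  linarith

theorem prod_sub_div_mul_pow {q : ℝ} (hq : 1 < q) {K M : ℕ} (hK : K ≤ M) :
    (∏ i ∈ Finset.range K, (q ^ M - q ^ i) / (q ^ M - 1)) *
        (1 - (q - 1) / (q ^ (M + 1) - 1)) ^ K =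
      ∏ i ∈ Finset.range (K + 1), (q ^ (M + 1) - q ^ i) / (q ^ (M + 1) - 1) := by
  have h1 : q ^ (M + 1) - 1 ≠ 0 := (sub_pos.2 (one_lt_pow₀ hq M.succ_ne_zero)).ne'
  rw [Finset.prod_range_succ', pow_zero, div_self h1, mul_one]
  nth_rewrite 2 [← Finset.card_range K]
  rw [← Finset.prod_const, ← Finset.prod_mul_distrib]
  refine Finset.prod_congr rfl fun i hi => ?_
  have hM : M ≠ 0 := by
    have := Finset.mem_range.1 hi
    omega
  have h2 : q ^ M - 1 ≠ 0 := (sub_pos.2 (one_lt_pow₀ hq hM)).ne'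
  field_simp
  ring

theorem natCast_mul_sub_one_div_le_one {q : ℝ} (hq : 1 < q) {n N : ℕ} (hn : n ≤ N)
    (hN : N ≠ 0) : n * ((q - 1) / (q ^ N - 1)) ≤ 1 := by
  have h1 : 0 < q ^ N - 1 := sub_pos.2 (one_lt_pow₀ hq hN)
  have h2 := one_add_mul_le_pow (a := q - 1) (by linarith) N
  have h3 : (n : ℝ) ≤ N := by exact_mod_cast hn
  rw [← mul_div_assoc, div_le_one h1]
  rw [add_sub_cancel] at h2
  nlinarith

/-- Among the weights on nonzero vectors that are constant on lines and have given total mass, the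
uniform one maximizes the total weight of the linearly independent tuples. -/
theorem indepTupleSum_le {F : Type*} [Field F] [Fintype F] (K : ℕ) {V : Type*} [AddCommGroup V]
    [Module F V] [Fintype V] (hK : K ≤ Module.finrank F V) {w : V → ℝ} (hw0 : ∀ x, 0 ≤ w x)
    (hw : ∀ (c : F) (x : V), c ≠ 0 → w (c • x) = w x) :
    indepTupleSum F K w ≤
      (∏ i ∈ Finset.range K, ((Fintype.card F : ℝ) ^ Module.finrank F V - (Fintype.card F) ^ i) /
        ((Fintype.card F : ℝ) ^ Module.finrank F V - 1)) * (∑ x with x ≠ 0, w x) ^ K := by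
  induction K generalizing V with
  | zero => simp [indepTupleSum]
  | succ K ih =>
    have hq : (1 : ℝ) < Fintype.card F := by exact_mod_cast Fintype.one_lt_card
    obtain ⟨M, hM⟩ : ∃ M, Module.finrank F V = M + 1 := ⟨_, (Nat.sub_add_cancel (by omega)).symm⟩
    have hKM : K ≤ M := by omega
    have hcard : (Fintype.card V : ℝ) = (Fintype.card F : ℝ) ^ (M + 1) := by
      rw [← hM]
      exact_mod_cast Module.card_eq_pow_finrank (K := F) (V := V)
    set q : ℝ := (Fintype.card F : ℝ)
    set W := ∑ x with x ≠ 0, w x with hWdef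
    have hW : 0 ≤ W := Finset.sum_nonneg fun x _ => hw0 x
    set u := (q - 1) / (q ^ (M + 1) - 1) with hu
    have hqM : 0 < q ^ (M + 1) - 1 := sub_pos.2 (one_lt_pow₀ hq M.succ_ne_zero)
    set c := ∏ i ∈ Finset.range K, (q ^ M - q ^ i) / (q ^ M - 1) with hc
    have hc0 : 0 ≤ c := Finset.prod_nonneg fun i hi => div_nonneg
      (sub_nonneg.2 (pow_le_pow_right₀ hq.le ((Finset.mem_range.1 hi).le.trans hKM)))
      (sub_nonneg.2 (one_le_pow₀ hq.le))
    have step : ∀ x : V, x ≠ 0 →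
        indepTupleSum F K (fun y : V ⧸ Submodule.span F {x} =>
          ∑ z with (Submodule.span F {x}).mkQ z = y, w z) ≤ c * (W - (q - 1) * w x) ^ K ∧
        (q - 1) * w x ≤ W := by
      intro x hx
      have hfin : Module.finrank F (V ⧸ Submodule.span F {x}) = M := by
        have := Submodule.finrank_quotient_add_finrank (Submodule.span F {x})
        rw [finrank_span_singleton hx] at this
        omega
      have hsum := sum_ne_zero_pushforward_mkQ hw hx
      constructor
      · have := ih (V := V ⧸ Submodule.span F {x}) (by omega)
          (w := fun y => ∑ z with (Submodule.span F {x}).mkQ z = y, w z)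
          (fun y => Finset.sum_nonneg fun z _ => hw0 z) (by
            intro a y ha
            refine (Finset.sum_bij (fun z _ => a • z) ?_ ?_ ?_ ?_).symm
            · intro z hz
              simp only [Finset.mem_filter, Finset.mem_univ, true_and] at hz ⊢
              rw [map_smul, hz]
            · intro z _ z' _ h
              exact smul_right_injective V ha h
            · intro z hz
              simp only [Finset.mem_filter, Finset.mem_univ, true_and] at hz
              refine ⟨a⁻¹ • z, ?_, smul_inv_smul₀ ha z⟩
              simp only [Finset.mem_filter, Finset.mem_univ, true_and]
              rw [map_smul, hz, inv_smul_smul₀ ha]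
            · intro z _
              exact (hw a z ha).symm)
        rwa [hfin, hsum] at this
      · have : 0 ≤ W - (q - 1) * w x := by
          rw [← hsum]
          exact Finset.sum_nonneg fun y _ => Finset.sum_nonneg fun z _ => hw0 z
        linarith
    obtain ⟨D, hD⟩ := exists_slope_mul_sub_pow_le K (u := u) (W := W) (by
      have := natCast_mul_sub_one_div_le_one hq (Nat.succ_le_succ hKM) M.succ_ne_zero
      push_cast at this
      exact this) hW
    have hcount : ((Finset.univ.filter fun x : V => x ≠ 0).card : ℝ) = q ^ (M + 1) - 1 := by
      rw [Finset.filter_ne', Finset.card_erase_of_mem (Finset.mem_univ 0), Finset.card_univ,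
        Nat.cast_sub Fintype.card_pos, hcard, Nat.cast_one]
    have huq : (q ^ (M + 1) - 1) * u = q - 1 := mul_div_cancel₀ _ hqM.ne'
    have hsumD : (q - 1) * ∑ x with x ≠ 0, w x * (W - (q - 1) * w x) ^ K ≤
        (q - 1) * (W ^ (K + 1) * (1 - u) ^ K) := by
      calc (q - 1) * ∑ x with x ≠ 0, w x * (W - (q - 1) * w x) ^ K
          = ∑ x with x ≠ 0, (q - 1) * w x * (W - (q - 1) * w x) ^ K := by
            rw [Finset.mul_sum]
            exact Finset.sum_congr rfl fun x _ => by ring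
        _ ≤ ∑ x : V with x ≠ 0,
            (W ^ (K + 1) * (u * (1 - u) ^ K) + D * ((q - 1) * w x - W * u)) := by
            refine Finset.sum_le_sum fun x hx => ?_
            exact hD _ (mul_nonneg (by linarith) (hw0 x)) (step x (Finset.mem_filter.1 hx).2).2
        _ = (q - 1) * (W ^ (K + 1) * (1 - u) ^ K) := by
            rw [Finset.sum_add_distrib, ← Finset.mul_sum _ _ D, Finset.sum_sub_distrib,
              ← Finset.mul_sum _ _ (q - 1), ← hWdef, Finset.sum_const, Finset.sum_const, nsmul_eq_mul,
              nsmul_eq_mul, hcount, ← huq]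
            ring
    rw [hM, ← prod_sub_div_mul_pow hq hKM, indepTupleSum_succ]
    calc _ ≤ ∑ x with x ≠ 0, w x * (c * (W - (q - 1) * w x) ^ K) :=
          Finset.sum_le_sum fun x hx =>
            mul_le_mul_of_nonneg_left (step x (Finset.mem_filter.1 hx).2).1 (hw0 x)
      _ = c * ∑ x with x ≠ 0, w x * (W - (q - 1) * w x) ^ K := by
          rw [Finset.mul_sum]
          exact Finset.sum_congr rfl fun x _ => by ring
      _ ≤ c * (W ^ (K + 1) * (1 - u) ^ K) :=
          mul_le_mul_of_nonneg_left (le_of_mul_le_mul_left hsumD (by linarith)) hc0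
      _ = _ := by ring

theorem indepTupleSum_const {F V : Type*} [Field F] [Fintype F] [AddCommGroup V] [Module F V]
    [Fintype V] {K : ℕ} (hK : K ≤ Module.finrank F V) {w : V → ℝ} {a : ℝ}
    (hw : ∀ x, x ≠ 0 → w x = a) :
    indepTupleSum F K w =
      (∏ i ∈ Finset.range K,
        ((Fintype.card F : ℝ) ^ Module.finrank F V - (Fintype.card F) ^ i)) * a ^ K := by
  have h1 : indepTupleSum F K w = ∑ v : Fin K → V, if LinearIndependent F v then a ^ K else 0 := by
    refine Finset.sum_congr rfl fun v _ => ?_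
    split_ifs with hv
    · rw [Finset.prod_congr rfl fun i _ => hw (v i) (hv.ne_zero i)]
      simp
    · rfl
  have h2 := card_linearIndependent (K := F) (V := V) hK
  rw [Nat.card_eq_fintype_card, Fintype.card_subtype] at h2
  rw [h1, ← Finset.sum_filter, Finset.sum_const, h2, nsmul_eq_mul, Nat.cast_prod,
    Finset.prod_range]
  congr 1
  refine Finset.prod_congr rfl fun i _ => ?_
  rw [Nat.cast_sub (Nat.pow_le_pow_right Fintype.card_pos (i.2.le.trans hK))]
  push_cast
  rfl

/-- The weight on vectors that spreads the weight of each projective point evenly over the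
nonzero vectors of the line. -/
noncomputable def vectorWeight (F : Type*) [Field F] [Fintype F] {V : Type*} [AddCommGroup V]
    [Module F V] (p : ℙ F V → ℝ) (x : V) : ℝ :=
  if hx : x ≠ 0 then p (Projectivization.mk F x hx) / (Fintype.card F - 1) else 0

theorem card_filter_mk_eq (F : Type*) [Field F] [Fintype F] {V : Type*} [AddCommGroup V]
    [Module F V] [Fintype V] (L : ℙ F V) :
    (Finset.univ.filter fun x : {x : V // x ≠ 0} =>
      Projectivization.mk F x.1 x.2 = L).card = Fintype.card F - 1 := by
  rw [← Fintype.card_units, ← Finset.card_univ]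
  symm
  refine Finset.card_bij (fun c _ => ⟨(c : F) • L.rep, smul_ne_zero c.ne_zero L.rep_nonzero⟩)
    ?_ ?_ ?_
  · intro c _
    simp only [Finset.mem_filter, Finset.mem_univ, true_and]
    conv_rhs => rw [← L.mk_rep]
    exact (Projectivization.mk_eq_mk_iff' F _ _ _ _).2 ⟨c, rfl⟩
  · intro c _ d _ h
    exact Units.ext (smul_left_injective F L.rep_nonzero (congrArg Subtype.val h))
  · rintro ⟨x, hx⟩ hL
    simp only [Finset.mem_filter, Finset.mem_univ, true_and] at hL
    subst hL
    obtain ⟨c, hc⟩ := Projectivization.exists_smul_eq_mk_rep F x hx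
    refine ⟨c⁻¹, Finset.mem_univ _, Subtype.ext ?_⟩
    simp only [← hc]
    exact inv_smul_smul c x

theorem sum_filter_mk_eq (F : Type*) [Field F] [Fintype F] {V : Type*} [AddCommGroup V]
    [Module F V] [Fintype V] (p : ℙ F V → ℝ) (L : ℙ F V) :
    ∑ x : {x : V // x ≠ 0} with Projectivization.mk F x.1 x.2 = L,
      vectorWeight F p x = p L := by
  have hq : (1 : ℝ) < Fintype.card F := by exact_mod_cast Fintype.one_lt_card
  have h : ∀ x ∈ Finset.univ.filter (fun x : {x : V // x ≠ 0} =>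
      Projectivization.mk F x.1 x.2 = L), vectorWeight F p x = p L / (Fintype.card F - 1) := by
    intro x hx
    rw [vectorWeight, dif_pos x.2, (Finset.mem_filter.1 hx).2]
  rw [Finset.sum_congr rfl h, Finset.sum_const, card_filter_mk_eq, nsmul_eq_mul,
    Nat.cast_sub Fintype.card_pos, Nat.cast_one, mul_div_cancel₀ _ (by linarith)]

theorem sum_vectorWeight (F : Type*) [Field F] [Fintype F] {V : Type*} [AddCommGroup V]
    [Module F V] [Fintype V] [Fintype (ℙ F V)] (p : ℙ F V → ℝ) :
    ∑ x with x ≠ 0, vectorWeight F p x = ∑ L, p L := by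
  rw [← Finset.sum_congr rfl fun L _ => sum_filter_mk_eq F p L,
    Finset.sum_fiberwise Finset.univ
      (fun x : {x : V // x ≠ 0} => Projectivization.mk F x.1 x.2) fun x => vectorWeight F p x,
    ← Finset.sum_subtype_eq_sum_filter]
  simp

theorem sum_independent_eq_indepTupleSum (F : Type*) [Field F] [Fintype F] {V : Type*}
    [AddCommGroup V] [Module F V] [Fintype V] [Fintype (ℙ F V)] (K : ℕ) (p : ℙ F V → ℝ) :
    ∑ f : Fin K → ℙ F V, (if Projectivization.Independent f then ∏ i, p (f i) else 0) =
      indepTupleSum F K (vectorWeight F p) := by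
  have hV : indepTupleSum F K (vectorWeight F p) =
      ∑ v : Fin K → {x : V // x ≠ 0},
        if LinearIndependent F (Subtype.val ∘ v) then ∏ i, vectorWeight F p (v i) else 0 := by
    rw [sum_tuple_pushforward Subtype.val (fun y => LinearIndependent F y)
      (fun x : {x : V // x ≠ 0} => vectorWeight F p x), indepTupleSum]
    refine Finset.sum_congr rfl fun y _ => ?_
    split_ifs with hy
    · refine Finset.prod_congr rfl fun i _ => ?_
      rw [Finset.sum_eq_single_of_mem ⟨y i, hy.ne_zero i⟩ (by simp)]
      intro b hb hne
      exact absurd (Subtype.ext (Finset.mem_filter.1 hb).2) hne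
    · rfl
  have hI : ∀ v : Fin K → {x : V // x ≠ 0}, LinearIndependent F (Subtype.val ∘ v) ↔
      Projectivization.Independent
        ((fun x : {x : V // x ≠ 0} => Projectivization.mk F x.1 x.2) ∘ v) := by
    intro v
    refine ⟨fun h => .mk _ (fun i => (v i).2) h, fun h => ?_⟩
    rw [Projectivization.independent_iff] at h
    choose a ha using fun i => Projectivization.exists_smul_eq_mk_rep F (v i).1 (v i).2
    convert! h.units_smul a⁻¹
    ext i
    simp [← ha]
  rw [hV]
  simp only [hI]
  rw [sum_tuple_pushforward _ (fun y => Projectivization.Independent y)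
    (fun x : {x : V // x ≠ 0} => vectorWeight F p x)]
  simp only [sum_filter_mk_eq]

theorem projProb_eq_indepTupleSum (F : Type*) [Field F] [Fintype F] (N K : ℕ)
    (p : ℙ F (Fin N → F) → ℝ) :
    projProb F N K p = indepTupleSum F K (vectorWeight F p) := by
  rw [← sum_independent_eq_indepTupleSum, projProb, factorial_mul_sum_powersetCard]
  refine Finset.sum_congr rfl fun f _ => ?_
  by_cases hf : Function.Injective f
  · have hiff : ProjIndep F N (Finset.univ.image f) ↔ Projectivization.Independent f := by
      rw [ProjIndep, Projectivization.independent_iff, Projectivization.independent_iff]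
      let e : Fin K ≃ {x // x ∈ Finset.univ.image f} := Equiv.ofBijective
        (fun i => ⟨f i, Finset.mem_image_of_mem _ (Finset.mem_univ i)⟩)
        ⟨fun i j hij => hf (congrArg Subtype.val hij), fun s => by
          obtain ⟨i, _, hi⟩ := Finset.mem_image.1 s.2
          exact ⟨i, Subtype.ext hi⟩⟩
      exact (linearIndependent_equiv e).symm
    simp only [if_pos hf, hiff, Finset.prod_image fun i _ j _ h => hf h]
  · rw [if_neg hf, if_neg]
    intro h
    rw [Projectivization.independent_iff] at h
    exact hf h.injective.of_comp

/-- **Full-rank matrices over finite fields.** For `1 ≤ K ≤ N`, the uniform distribution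
`u_L = (q−1)/(q^N−1)` on `PG(N−1, q)` maximizes the probability that `K` i.i.d.
projective row classes have full row rank, over all distributions `p`. -/
theorem projProb_le_uniform (F : Type*) [Field F] [Fintype F] (q : ℕ)
    (hq : q = Fintype.card F) (N K : ℕ) (hN : 1 ≤ N) (hK : 1 ≤ K) (hKN : K ≤ N)
    (p : ℙ F (Fin N → F) → ℝ) (hp0 : ∀ L, 0 ≤ p L) (hp1 : ∑ L, p L = 1) :
    projProb F N K p ≤
      projProb F N K (fun _ => ((q : ℝ) - 1) / ((q : ℝ) ^ N - 1)) := by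
  have hq1 : (1 : ℝ) < Fintype.card F := by exact_mod_cast Fintype.one_lt_card
  have hfin : K ≤ Module.finrank F (Fin N → F) := by simpa using hKN
  subst hq
  rw [projProb_eq_indepTupleSum, projProb_eq_indepTupleSum]
  refine (indepTupleSum_le K hfin ?_ ?_).trans_eq ?_
  · intro x
    rw [vectorWeight]
    split_ifs
    · exact div_nonneg (hp0 _) (by linarith)
    · exact le_rfl
  · intro c x hc
    by_cases hx : x = 0
    · simp [hx]
    · rw [vectorWeight, vectorWeight, dif_pos hx, dif_pos (smul_ne_zero hc hx),
        (Projectivization.mk_eq_mk_iff' F _ _ _ hx).2 ⟨c, rfl⟩]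
  · rw [indepTupleSum_const hfin (a := 1 / ((Fintype.card F : ℝ) ^ N - 1)), sum_vectorWeight, hp1,
      one_pow, mul_one, Finset.prod_div_distrib, Finset.prod_const, Finset.card_range,
      Module.finrank_fin_fun, one_div, inv_pow, div_eq_mul_inv]
    intro x hx
    rw [vectorWeight, dif_pos hx]
    have : (Fintype.card F : ℝ) - 1 ≠ 0 := by linarith
    field_simp
end

section
/- Let q be a prime power, N ≥ 1, 1 ≤ K ≤ N, and let P be a probability distribution on 𝔽_q^N \ {0}. Define the projective pushforward p on PG(N−1, q) by p_L = Σ_{v ∈ L, v ≠ 0} P(v). Then the probability that K i.i.d. vectors X_1,…,X_K drawn from P are linearly independent in 𝔽_q^N equals F_K(p) = K! · Σ_{S ⊆ PG(N−1,q) independent, |S| = K} Π_{L ∈ S} p_L. -/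
open Finset Classical
open scoped LinearAlgebra.Projectivization

theorem Finset.card_filter_injective_image_eq {α : Type*} [Fintype α] {K : ℕ}
    {S : Finset α} (hS : S.card = K) :
    (univ.filter fun l : Fin K → α => Function.Injective l ∧ univ.image l = S).card
      = K.factorial := by
  have e₀ : Fin K ≃ S := (S.equivFinOfCardEq hS).symm
  have hcard : (univ : Finset (Fin K ≃ S)).card = K.factorial := by
    rw [Finset.card_univ, Fintype.card_equiv e₀, Fintype.card_fin]
  rw [← hcard]
  symm
  refine Finset.card_bij (fun e _ i => (e i : α)) ?_ ?_ ?_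
  · intro e _
    refine mem_filter.2 ⟨mem_univ _, Subtype.val_injective.comp e.injective, ?_⟩
    ext a
    simp only [mem_image, mem_univ, true_and]
    constructor
    · rintro ⟨i, rfl⟩
      exact (e i).2
    · intro ha
      exact ⟨e.symm ⟨a, ha⟩, by simp⟩
  · intro e₁ _ e₂ _ h
    ext i
    exact congrFun h i
  · intro l hl
    obtain ⟨-, hinj, him⟩ := mem_filter.1 hl
    have hmem : ∀ i, l i ∈ S := fun i => him ▸ mem_image_of_mem l (mem_univ i)
    refine ⟨Equiv.ofBijective (fun i => ⟨l i, hmem i⟩) ⟨?_, ?_⟩, mem_univ _, rfl⟩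
    · intro i j h
      exact hinj (congrArg Subtype.val h)
    · rintro ⟨a, ha⟩
      rw [← him] at ha
      obtain ⟨i, -, rfl⟩ := mem_image.1 ha
      exact ⟨i, rfl⟩

theorem Finset.sum_injective_image_eq_factorial_mul {α R : Type*} [Fintype α]
    [CommSemiring R] (K : ℕ) (f : Finset α → R) :
    (∑ l : Fin K → α, if Function.Injective l then f (univ.image l) else 0)
      = K.factorial * ∑ S ∈ univ.powersetCard K, f S := by
  have hmaps : ∀ l ∈ univ.filter (fun l : Fin K → α => Function.Injective l),
      univ.image l ∈ (univ : Finset α).powersetCard K := by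
    intro l hl
    rw [mem_powersetCard]
    exact ⟨subset_univ _, by
      rw [card_image_of_injective _ (mem_filter.1 hl).2, card_univ, Fintype.card_fin]⟩
  rw [← sum_filter, ← sum_fiberwise_of_maps_to hmaps, mul_sum]
  refine sum_congr rfl fun S hS => ?_
  rw [filter_filter, sum_congr rfl (g := fun _ => f S)
    (fun l hl => by rw [(mem_filter.1 hl).2.2]), sum_const,
    card_filter_injective_image_eq (mem_powersetCard.1 hS).2, nsmul_eq_mul]

theorem Projectivization.independent_mk_iff {ι F V : Type*} [Field F] [AddCommGroup V]
    [Module F V] (x : ι → {v : V // v ≠ 0}) :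
    Projectivization.Independent (fun i => Projectivization.mk F (x i).1 (x i).2)
      ↔ LinearIndependent F (fun i => (x i : V)) := by
  refine ⟨fun h => ?_, fun h => Projectivization.Independent.mk _ (fun i => (x i).2) h⟩
  rw [Projectivization.independent_iff] at h
  choose a ha using fun i => Projectivization.exists_smul_eq_mk_rep F (x i).1 (x i).2
  have hrep : Projectivization.rep ∘ (fun i => Projectivization.mk F (x i).1 (x i).2)
      = a • fun i => (x i : V) := funext fun i => (ha i).symm
  rw [hrep] at h
  exact (LinearIndependent.units_smul_iff _ a).1 h

theorem Projectivization.Independent.injective {ι F V : Type*} [Field F] [AddCommGroup V]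
    [Module F V] {l : ι → ℙ F V} (h : Projectivization.Independent l) :
    Function.Injective l :=
  (Projectivization.independent_iff.1 h).injective.of_comp

theorem projIndep_image_iff {F : Type*} [Field F] [Fintype F] {N K : ℕ}
    {l : Fin K → ℙ F (Fin N → F)} (hl : Function.Injective l) :
    ProjIndep F N (univ.image l) ↔ Projectivization.Independent l := by
  have hmem : ∀ i, l i ∈ univ.image l := fun i => mem_image_of_mem l (mem_univ i)
  have hbij : Function.Bijective
      (fun i => (⟨l i, hmem i⟩ : {L // L ∈ univ.image l})) := by
    refine ⟨fun i j h => hl (congrArg Subtype.val h), ?_⟩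
    rintro ⟨a, ha⟩
    obtain ⟨i, -, rfl⟩ := mem_image.1 ha
    exact ⟨i, rfl⟩
  rw [ProjIndep, Projectivization.independent_iff, Projectivization.independent_iff]
  exact (linearIndependent_equiv (Equiv.ofBijective _ hbij)).symm

theorem sum_independent_prod_eq_projProb {F : Type*} [Field F] [Fintype F] {N K : ℕ}
    (p : ℙ F (Fin N → F) → ℝ) :
    (∑ l : Fin K → ℙ F (Fin N → F),
        if Projectivization.Independent l then ∏ i, p (l i) else 0)
      = projProb F N K p := by
  rw [projProb, ← sum_injective_image_eq_factorial_mul]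
  refine sum_congr rfl fun l _ => ?_
  by_cases hl : Function.Injective l
  · simp only [hl, if_true, projIndep_image_iff hl]
    rw [prod_image hl.injOn]
  · rw [if_neg hl, if_neg fun h => hl h.injective]

theorem Finset.sum_ite_prod_pushforward {ι α β R : Type*} [Fintype ι] [Fintype α]
    [Fintype β] [DecidableEq ι] [DecidableEq β] [CommSemiring R] (g : α → β) (P : α → R) (Q : (ι → β) → Prop) :
    (∑ l : ι → β, if Q l then ∏ i, ∑ a, (if g a = l i then P a else 0) else 0)
      = ∑ x : ι → α, if Q (fun i => g (x i)) then ∏ i, P (x i) else 0 := by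
  have key : ∀ l : ι → β, (if Q l then ∏ i, ∑ a, (if g a = l i then P a else 0) else 0)
      = ∑ x : ι → α, if (fun i => g (x i)) = l then
          (if Q (fun i => g (x i)) then ∏ i, P (x i) else 0) else 0 := by
    intro l
    rw [Fintype.prod_sum]
    by_cases hQ : Q l
    · rw [if_pos hQ]
      refine sum_congr rfl fun x _ => ?_
      by_cases hx : (fun i => g (x i)) = l
      · subst hx
        simp [hQ]
      · rw [if_neg hx]
        obtain ⟨i, hi⟩ := Function.ne_iff.1 hx
        exact prod_eq_zero (mem_univ i) (if_neg hi)
    · rw [if_neg hQ]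
      refine (sum_eq_zero fun x _ => ?_).symm
      split_ifs with hx hQ'
      · exact absurd (hx ▸ hQ') hQ
      all_goals rfl
  simp_rw [key]
  rw [sum_comm]
  simp

/-- **Vector-level sampling reduces to the projective pushforward.** If `P` is a
distribution on the nonzero vectors of `𝔽_q^N` and `p` is its projective pushforward,
then the probability that `K` i.i.d. vectors drawn from `P` are linearly independent
equals `F_K(p) = K! · ∑_{S independent, |S| = K} ∏_{L ∈ S} p_L`. -/
theorem prob_linearIndependent_eq_projProb_pushforward
    (F : Type*) [Field F] [Fintype F] (N K : ℕ) (hN : 1 ≤ N) (hK : 1 ≤ K) (hKN : K ≤ N)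
    (P : {v : Fin N → F // v ≠ 0} → ℝ) (hP0 : ∀ v, 0 ≤ P v) (hP1 : ∑ v, P v = 1)
    (p : ℙ F (Fin N → F) → ℝ)
    (hp : ∀ L, p L = ∑ v : {v : Fin N → F // v ≠ 0},
      if Projectivization.mk F v.1 v.2 = L then P v else 0) :
    (∑ x : Fin K → {v : Fin N → F // v ≠ 0},
        if LinearIndependent F (fun i => (x i : Fin N → F)) then ∏ i, P (x i) else 0)
      = projProb F N K p := by
  rw [← sum_independent_prod_eq_projProb]
  simp only [hp]
  rw [sum_ite_prod_pushforward
    (fun v : {v : Fin N → F // v ≠ 0} => Projectivization.mk F v.1 v.2) P]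
  refine sum_congr rfl fun x _ => if_congr (Projectivization.independent_mk_iff x).symm rfl rfl
end

section
/- Let q be a prime power, N ≥ 2, and let 2 ≤ K ≤ N. Let E = PG(N−1, q) and let u be the uniform distribution on E. Then there exists a constant c > 0 (depending on N, q, K) such that F_K(u) − F_K(p) ≥ c·‖p − u‖_2² for every probability distribution p on E. Consequently, u is the unique maximizer of F_K over the probability simplex Δ(E). -/
open Finset Classical
open scoped LinearAlgebra.Projectivization

theorem tangent_pow_succ (n : ℕ) {a y : ℝ} (ha : 0 < a) (ha1 : a ≤ 1) (hy : 0 ≤ y)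
    (hna : n ≤ (n + 1) * a) :
    ∃ Q, y ^ (n + 1) = a ^ (n + 1) + (n + 1) * a ^ n * (y - a) + (y - a) ^ 2 * Q ∧
      (1 - y) * Q * a ≤ n * a ^ n := by
  induction n with
  | zero => exact ⟨0, by simp, by simp⟩
  | succ n ih =>
    push_cast at hna ⊢
    have hna' : (n : ℝ) ≤ (n + 1) * a := by linarith
    obtain ⟨Q, hQ, hle⟩ := ih hna'
    refine ⟨y * Q + (n + 1) * a ^ n, ?_, ?_⟩
    · rw [pow_succ y, hQ]
      ring
    · have h₁ := mul_le_mul_of_nonneg_left hle hy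
      have h₂ : 0 ≤ y * a ^ n * ((n + 1) * a - n) :=
        mul_nonneg (by positivity) (sub_nonneg.2 hna')
      linear_combination h₁ + h₂

theorem mul_pow_le_tangent (n : ℕ) {a x : ℝ} (ha : 0 < a) (ha1 : a ≤ 1) (hx1 : x ≤ 1)
    (hna : n ≤ (n + 1) * a) :
    x * (1 - x) ^ (n + 1) ≤ (1 - a) * a ^ (n + 1) +
      ((n + 2) * a ^ (n + 1) - (n + 1) * a ^ n) * (x - (1 - a)) -
      a ^ n * ((n + 1) * a - n) / a * (x - (1 - a)) ^ 2 := by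
  obtain ⟨Q, hQ, hle⟩ :=
    tangent_pow_succ n ha ha1 (sub_nonneg.2 hx1) hna
  have h₁ : a ^ n * ((n + 1) * a - n) / a ≤ (n + 1) * a ^ n - x * Q := by
    rw [div_le_iff₀ ha]
    linear_combination hle
  have h₂ := mul_le_mul_of_nonneg_right h₁ (sq_nonneg (x - (1 - a)))
  rw [hQ]
  linear_combination h₂

/-- The coefficient of the quadratic error term in `sum_mul_pow_le_sub`. -/
noncomputable def stabilityConst (n M : ℕ) : ℝ :=
  (1 - (M : ℝ)⁻¹) ^ n * ((n + 1) * (1 - (M : ℝ)⁻¹) - n) / (1 - (M : ℝ)⁻¹)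

theorem lt_succ_mul_one_sub_inv {n M : ℕ} (hM : n + 2 ≤ M) :
    (n : ℝ) < (n + 1) * (1 - (M : ℝ)⁻¹) := by
  have h₁ : (n : ℝ) + 2 ≤ M := by exact_mod_cast hM
  have h₂ : (0 : ℝ) < M := by linarith [(Nat.cast_nonneg n : (0 : ℝ) ≤ n)]
  have h₃ : ((n : ℝ) + 1) * (M : ℝ)⁻¹ < 1 := by
    rw [← div_eq_mul_inv, div_lt_one h₂]
    linarith
  linarith

theorem one_sub_inv_pos {M : ℕ} (hM : 2 ≤ M) : (0 : ℝ) < 1 - (M : ℝ)⁻¹ := by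
  simpa using lt_succ_mul_one_sub_inv (n := 0) hM

theorem stabilityConst_pos {n M : ℕ} (hM : n + 2 ≤ M) : 0 < stabilityConst n M := by
  have h₁ := one_sub_inv_pos (show 2 ≤ M by lia)
  have h₂ := sub_pos.2 (lt_succ_mul_one_sub_inv hM)
  unfold stabilityConst
  positivity

theorem sum_mul_pow_le_sub {ι : Type*} {n M : ℕ} (hM : n + 2 ≤ M) {s : Finset ι} {x : ι → ℝ}
    (hs : s.card = M) (hx : ∀ i ∈ s, 0 ≤ x i) (hsum : ∑ i ∈ s, x i = 1) :
    ∑ i ∈ s, x i * (1 - x i) ^ (n + 1) ≤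
      (1 - (M : ℝ)⁻¹) ^ (n + 1) - stabilityConst n M * ∑ i ∈ s, (x i - (M : ℝ)⁻¹) ^ 2 := by
  have hM₀ : (M : ℝ) ≠ 0 := by
    have : M ≠ 0 := by lia
    exact_mod_cast this
  have hlin : ∑ i ∈ s, (x i - (M : ℝ)⁻¹) = 0 := by
    rw [Finset.sum_sub_distrib, hsum, Finset.sum_const, hs, nsmul_eq_mul, mul_inv_cancel₀ hM₀,
      sub_self]
  have hconst : ∑ _i ∈ s, (M : ℝ)⁻¹ * (1 - (M : ℝ)⁻¹) ^ (n + 1) = (1 - (M : ℝ)⁻¹) ^ (n + 1) := by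
    rw [Finset.sum_const, hs, nsmul_eq_mul, mul_inv_cancel_left₀ hM₀]
  have hpt : ∀ i ∈ s, x i * (1 - x i) ^ (n + 1) ≤ (M : ℝ)⁻¹ * (1 - (M : ℝ)⁻¹) ^ (n + 1) +
      ((n + 2) * (1 - (M : ℝ)⁻¹) ^ (n + 1) - (n + 1) * (1 - (M : ℝ)⁻¹) ^ n) * (x i - (M : ℝ)⁻¹) -
      stabilityConst n M * (x i - (M : ℝ)⁻¹) ^ 2 := fun i hi => by
    have := mul_pow_le_tangent n (one_sub_inv_pos (show 2 ≤ M by lia))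
      (sub_le_self 1 (by positivity)) (hsum ▸ Finset.single_le_sum hx hi)
      (lt_succ_mul_one_sub_inv hM).le
    rwa [sub_sub_cancel] at this
  calc _ ≤ _ := Finset.sum_le_sum hpt
    _ = _ := by
      rw [Finset.sum_sub_distrib, Finset.sum_add_distrib, hconst, ← Finset.mul_sum, hlin,
        ← Finset.mul_sum, mul_zero, add_zero]

theorem sum_mul_sub_pow_le {ι : Type*} {n M : ℕ} (hM : n + 1 ≤ M) {s : Finset ι} {x : ι → ℝ}
    (hs : s.card = M) (hx : ∀ i ∈ s, 0 ≤ x i) :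
    ∑ i ∈ s, x i * (∑ j ∈ s, x j - x i) ^ n ≤
      (1 - (M : ℝ)⁻¹) ^ n * (∑ j ∈ s, x j) ^ (n + 1) := by
  obtain _ | n := n
  · simp
  set S := ∑ j ∈ s, x j with hS
  obtain hS₀ | hS₀ := (Finset.sum_nonneg hx).eq_or_lt
  · have hx₀ : ∀ i ∈ s, x i = 0 := (Finset.sum_eq_zero_iff_of_nonneg hx).1 hS₀.symm
    rw [Finset.sum_eq_zero fun i hi => by rw [hx₀ i hi, zero_mul], hS, ← hS₀]
    simp
  · rw [← hS] at hS₀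
    have key := sum_mul_pow_le_sub hM (x := fun i => x i / S) hs
      (fun i hi => div_nonneg (hx i hi) hS₀.le)
      (by rw [← Finset.sum_div, ← hS, div_self hS₀.ne'])
    have hle : ∑ i ∈ s, x i / S * (1 - x i / S) ^ (n + 1) ≤ (1 - (M : ℝ)⁻¹) ^ (n + 1) :=
      key.trans (sub_le_self _
        (mul_nonneg (stabilityConst_pos hM).le (Finset.sum_nonneg fun i _ => sq_nonneg _)))
    calc ∑ i ∈ s, x i * (S - x i) ^ (n + 1)
        = (∑ i ∈ s, x i / S * (1 - x i / S) ^ (n + 1)) * S ^ (n + 2) := by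
          rw [Finset.sum_mul]
          refine Finset.sum_congr rfl fun i _ => ?_
          have : S - x i = S * (1 - x i / S) := by field_simp
          rw [this, mul_pow]
          field_simp
          ring
      _ ≤ _ := mul_le_mul_of_nonneg_right hle (by positivity)

section Geometry

variable {F V : Type*} [Field F] [AddCommGroup V] [Module F V]

/-- The points of `S` are independent modulo `W`. -/
def IndepMod (W : Submodule F V) (S : Finset (ℙ F V)) : Prop :=
  Module.finrank F ↥(W ⊔ S.sup Projectivization.submodule) = Module.finrank F W + S.card

theorem projectivization_independent_iff (S : Finset (ℙ F V)) :
    Projectivization.Independent (fun x : {x // x ∈ S} => (x : ℙ F V)) ↔ IndepMod ⊥ S := by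
  have h : Submodule.span F (Set.range (Projectivization.rep ∘ fun x : {x // x ∈ S} => (x : ℙ F V)))
      = S.sup Projectivization.submodule := by
    rw [Submodule.span_range_eq_iSup, Finset.sup_eq_iSup, iSup_subtype]
    simp [Projectivization.submodule_eq]
  rw [Projectivization.independent_iff, linearIndependent_iff_card_eq_finrank_span, Set.finrank, h,
    IndepMod, bot_sup_eq, finrank_bot, zero_add, Fintype.card_coe, eq_comm]

theorem range_map_subtype (W : Submodule F V) :
    Set.range (Projectivization.map W.subtype W.injective_subtype) =
      {L : ℙ F V | L.submodule ≤ W} := by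
  ext L
  constructor
  · rintro ⟨M, rfl⟩
    induction M using Projectivization.ind with | h w hw => ?_
    rw [Projectivization.map_mk, Set.mem_ofPred_eq, Projectivization.submodule_mk,
      Submodule.span_singleton_le_iff_mem]
    exact w.2
  · intro hL
    rw [Set.mem_ofPred_eq, Projectivization.submodule_eq, Submodule.span_singleton_le_iff_mem] at hL
    refine ⟨Projectivization.mk F ⟨L.rep, hL⟩ fun h => L.rep_nonzero (congrArg Subtype.val h), ?_⟩
    rw [Projectivization.map_mk]
    exact L.mk_rep

section

variable [Fintype (ℙ F V)]

/-- The points of `ℙ F V` that do not lie on `W`. -/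
noncomputable def pointsOutside (W : Submodule F V) : Finset (ℙ F V) :=
  Finset.univ.filter fun L => ¬ L.submodule ≤ W

theorem pointsOutside_sup_subset (W U : Submodule F V) :
    pointsOutside (W ⊔ U) ⊆ pointsOutside W := by
  intro L hL
  simp only [pointsOutside, Finset.mem_filter, Finset.mem_univ, true_and] at hL ⊢
  exact fun h => hL (h.trans le_sup_left)

/-- The weighted count of `K`-tuples of points that are independent modulo `W`. -/
noncomputable def relProb (K : ℕ) (W : Submodule F V) (p : ℙ F V → ℝ) : ℝ :=
  (K.factorial : ℝ) *
    ∑ S ∈ Finset.univ.powersetCard K, if IndepMod W S then ∏ L ∈ S, p L else 0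

theorem relProb_zero (W : Submodule F V) (p : ℙ F V → ℝ) : relProb 0 W p = 1 := by
  have h : IndepMod W (∅ : Finset (ℙ F V)) := by
    rw [IndepMod, Finset.sup_empty, sup_bot_eq, Finset.card_empty, add_zero]
  simp [relProb, h]

theorem pointsOutside_bot : pointsOutside (⊥ : Submodule F V) = Finset.univ := by
  refine Finset.filter_true_of_mem fun L _ h => ?_
  have := Submodule.finrank_mono h
  simp [L.finrank_submodule] at this

theorem pointsOutside_submodule (L : ℙ F V) :
    pointsOutside L.submodule = Finset.univ.erase L := by
  ext L'
  simp only [pointsOutside, Finset.mem_filter, Finset.mem_univ, true_and, Finset.mem_erase,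
    and_true]
  refine not_congr ⟨fun h => ?_, fun h => h ▸ le_rfl⟩
  exact Projectivization.submodule_injective (Submodule.eq_of_le_of_finrank_eq h
    (by rw [L.finrank_submodule, L'.finrank_submodule]))

theorem card_points_le [Finite F] (W : Submodule F V) :
    (Finset.univ.filter fun L : ℙ F V => L.submodule ≤ W).card =
      ∑ i ∈ Finset.range (Module.finrank F W), Nat.card F ^ i := by
  rw [← Projectivization.card_of_finrank F W rfl, ← Set.ncard_coe_finset, Finset.coe_filter,
    ← Nat.card_range_of_injective (Projectivization.map_injective W.subtype W.injective_subtype),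
    range_map_subtype]
  simp only [Finset.mem_univ, true_and, Nat.card_coe_set_eq]

theorem card_pointsOutside [Finite F] {W : Submodule F V} {r : ℕ}
    (h : Module.finrank F W + r = Module.finrank F V) :
    (pointsOutside W).card =
      Nat.card F ^ Module.finrank F W * ∑ i ∈ Finset.range r, Nat.card F ^ i := by
  have h₁ := Finset.card_filter_add_card_filter_not (s := Finset.univ)
    fun L : ℙ F V => L.submodule ≤ W
  rw [card_points_le, Finset.card_univ, ← Nat.card_eq_fintype_card,
    Projectivization.card_of_finrank F V h.symm, Finset.sum_range_add] at h₁
  simp_rw [Finset.mul_sum, ← pow_add]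
  exact Nat.add_left_cancel h₁

end

variable [FiniteDimensional F V]

theorem finrank_sup_submodule_le (W : Submodule F V) (L : ℙ F V) :
    Module.finrank F ↥(W ⊔ L.submodule) ≤ Module.finrank F W + 1 := by
  simpa [L.finrank_submodule] using Submodule.finrank_add_le_finrank_add_finrank W L.submodule

theorem finrank_sup_submodule {W : Submodule F V} {L : ℙ F V} (h : ¬ L.submodule ≤ W) :
    Module.finrank F ↥(W ⊔ L.submodule) = Module.finrank F W + 1 :=
  (finrank_sup_submodule_le W L).antisymm <|
    Submodule.finrank_lt_finrank_of_lt (left_lt_sup.2 h)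

theorem finrank_sup_finset_sup_le (W : Submodule F V) (S : Finset (ℙ F V)) :
    Module.finrank F ↥(W ⊔ S.sup Projectivization.submodule) ≤ Module.finrank F W + S.card := by
  induction S using Finset.induction_on with
  | empty => rw [Finset.sup_empty, sup_bot_eq, Finset.card_empty, add_zero]
  | insert L S hL ih =>
    rw [Finset.sup_insert, sup_comm L.submodule, ← sup_assoc, Finset.card_insert_of_notMem hL,
      ← add_assoc]
    exact (finrank_sup_submodule_le _ L).trans (Nat.add_le_add_right ih 1)

theorem IndepMod.notMem {W : Submodule F V} {L : ℙ F V} {T : Finset (ℙ F V)}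
    (h : IndepMod (W ⊔ L.submodule) T) : L ∉ T := fun hL => by
  have h₁ := finrank_sup_finset_sup_le (W ⊔ L.submodule) (T.erase L)
  have h₂ : (W ⊔ L.submodule) ⊔ T.sup Projectivization.submodule =
      (W ⊔ L.submodule) ⊔ (T.erase L).sup Projectivization.submodule := by
    rw [← Finset.insert_erase hL, Finset.sup_insert, ← sup_assoc, sup_assoc W, sup_idem,
      Finset.insert_erase hL]
  have h₃ := Finset.card_erase_add_one hL
  rw [IndepMod, h₂] at h
  lia

theorem indepMod_insert {W : Submodule F V} {L : ℙ F V} {T : Finset (ℙ F V)} (hL : L ∉ T) :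
    IndepMod W (insert L T) ↔ ¬ L.submodule ≤ W ∧ IndepMod (W ⊔ L.submodule) T := by
  unfold IndepMod
  rw [Finset.sup_insert, ← sup_assoc, Finset.card_insert_of_notMem hL]
  by_cases h : L.submodule ≤ W
  · have := finrank_sup_finset_sup_le W T
    rw [sup_eq_left.2 h]
    simp only [h, not_true_eq_false, false_and, iff_false]
    lia
  · rw [finrank_sup_submodule h]
    simp only [h, not_false_eq_true, true_and]
    lia

variable [Fintype (ℙ F V)]

theorem relProb_succ (K : ℕ) (W : Submodule F V) (p : ℙ F V → ℝ) :
    relProb (K + 1) W p =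
      ∑ L ∈ pointsOutside W, p L * relProb K (W ⊔ L.submodule) p := by
  have key : ((K + 1 : ℕ) : ℝ) *
      ∑ S ∈ Finset.univ.powersetCard (K + 1), (if IndepMod W S then ∏ L ∈ S, p L else 0) =
      ∑ L ∈ pointsOutside W, p L *
        ∑ T ∈ Finset.univ.powersetCard K,
          if IndepMod (W ⊔ L.submodule) T then ∏ L' ∈ T, p L' else 0 := by
    simp_rw [← Finset.sum_filter]
    calc _ = ∑ S ∈ (Finset.univ.powersetCard (K + 1)).filter (IndepMod W),
          ∑ _L ∈ S, ∏ L' ∈ S, p L' := by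
          rw [Finset.mul_sum]
          refine Finset.sum_congr rfl fun S hS => ?_
          rw [Finset.sum_const, (Finset.mem_powersetCard.1 (Finset.mem_filter.1 hS).1).2,
            nsmul_eq_mul]
      _ = _ := by
          simp_rw [Finset.mul_sum]
          rw [Finset.sum_sigma', Finset.sum_sigma']
          refine Finset.sum_bij' (fun x _ => ⟨x.2, x.1.erase x.2⟩)
            (fun x _ => ⟨insert x.1 x.2, x.1⟩) ?_ ?_ ?_ ?_ ?_
          · rintro ⟨S, L⟩ h
            simp only [Finset.mem_sigma, Finset.mem_filter, Finset.mem_powersetCard_univ,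
              pointsOutside, Finset.mem_univ, true_and] at h ⊢
            obtain ⟨⟨hcard, hS⟩, hL⟩ := h
            rw [← Finset.insert_erase hL, indepMod_insert (Finset.notMem_erase L S)] at hS
            exact ⟨hS.1, by rw [Finset.card_erase_of_mem hL, hcard]; rfl, hS.2⟩
          · rintro ⟨L, T⟩ h
            simp only [Finset.mem_sigma, Finset.mem_filter, Finset.mem_powersetCard_univ,
              pointsOutside, Finset.mem_univ, true_and] at h ⊢
            obtain ⟨hL, hcard, hT⟩ := h
            rw [indepMod_insert hT.notMem, Finset.card_insert_of_notMem hT.notMem, hcard]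
            exact ⟨⟨rfl, hL, hT⟩, Finset.mem_insert_self L T⟩
          · rintro ⟨S, L⟩ h
            simp only [Finset.mem_sigma] at h
            simp [Finset.insert_erase h.2]
          · rintro ⟨L, T⟩ h
            simp only [Finset.mem_sigma, Finset.mem_filter] at h
            simp [Finset.erase_insert h.2.2.notMem]
          · rintro ⟨S, L⟩ h
            simp only [Finset.mem_sigma] at h
            exact (Finset.mul_prod_erase S p h.2).symm
  unfold relProb
  rw [Nat.factorial_succ, mul_comm (K + 1), Nat.cast_mul, mul_assoc, key, Finset.mul_sum]
  exact Finset.sum_congr rfl fun L _ => mul_left_comm _ _ _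

theorem projProb_eq_relProb (F : Type*) [Field F] [Fintype F] (N K : ℕ)
    (p : ℙ F (Fin N → F) → ℝ) : projProb F N K p = relProb K ⊥ p := by
  unfold projProb relProb ProjIndep
  simp_rw [projectivization_independent_iff]

theorem filter_sup_submodule_eq {W : Submodule F V} {L : ℙ F V} (hL : L ∈ pointsOutside W) :
    (pointsOutside W).filter (fun L' => W ⊔ L'.submodule = W ⊔ L.submodule) =
      pointsOutside W \ pointsOutside (W ⊔ L.submodule) := by
  ext L'
  simp only [pointsOutside, Finset.mem_filter, Finset.mem_univ, true_and, Finset.mem_sdiff,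
    not_not] at hL ⊢
  refine and_congr_right fun hL' => ⟨fun h => h ▸ le_sup_right, fun h => ?_⟩
  refine Submodule.eq_of_le_of_finrank_eq (sup_le le_sup_left h) ?_
  rw [finrank_sup_submodule hL, finrank_sup_submodule hL']

/-- The probability that `K` independent uniform points of a projective space of rank `r` over a
field with `q` elements are linearly independent. -/
noncomputable def uniformProb (q : ℕ) : ℕ → ℕ → ℝ
  | 0, _ => 1
  | K + 1, r =>
    uniformProb q K (r - 1) * (1 - ((∑ i ∈ Finset.range r, q ^ i : ℕ) : ℝ)⁻¹) ^ K

theorem le_sum_range_pow {q : ℕ} (hq : 0 < q) (r : ℕ) : r ≤ ∑ i ∈ Finset.range r, q ^ i := by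
  simpa using Finset.card_nsmul_le_sum (Finset.range r) (fun i => q ^ i) 1
    fun i _ => Nat.one_le_pow i q hq

theorem uniformProb_pos {q : ℕ} (hq : 0 < q) {K r : ℕ} (h : K ≤ r) : 0 < uniformProb q K r := by
  induction K generalizing r with
  | zero => exact one_pos
  | succ K ih =>
    refine mul_pos (ih (by lia)) ?_
    obtain rfl | hK := K.eq_zero_or_pos
    · simp
    · exact pow_pos (one_sub_inv_pos (by have := le_sum_range_pow hq r; lia)) K

theorem card_pointsOutside_succ [Finite F] {W : Submodule F V} {r : ℕ}
    (h : Module.finrank F W + (r + 1) = Module.finrank F V) {L : ℙ F V}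
    (hL : L ∈ pointsOutside W) :
    (pointsOutside W).card =
      (pointsOutside (W ⊔ L.submodule)).card + Nat.card F ^ Module.finrank F W := by
  have hrank := finrank_sup_submodule (Finset.mem_filter.1 hL).2
  rw [card_pointsOutside h, card_pointsOutside (r := r) (by lia), hrank, geom_sum_succ]
  ring

theorem card_image_sup_submodule [Finite F] {W : Submodule F V} {r : ℕ}
    (h : Module.finrank F W + (r + 1) = Module.finrank F V) :
    ((pointsOutside W).image fun L : ℙ F V => W ⊔ L.submodule).card =
      ∑ i ∈ Finset.range (r + 1), Nat.card F ^ i := by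
  have hpos : 0 < Nat.card F ^ Module.finrank F W := pow_pos Nat.card_pos _
  refine Nat.eq_of_mul_eq_mul_left hpos ?_
  rw [← card_pointsOutside h, Finset.card_eq_sum_card_image (fun L : ℙ F V => W ⊔ L.submodule),
    Finset.sum_const_nat, mul_comm]
  simp only [Finset.forall_mem_image]
  intro L hL
  rw [filter_sup_submodule_eq hL, Finset.card_sdiff_of_subset (pointsOutside_sup_subset W _),
    card_pointsOutside_succ h hL, Nat.add_sub_cancel_left]

theorem relProb_le [Finite F] {K r : ℕ} (hK : K ≤ r) {W : Submodule F V} {p : ℙ F V → ℝ}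
    (hp : ∀ L, 0 ≤ p L) (h : Module.finrank F W + r = Module.finrank F V) :
    relProb K W p ≤ uniformProb (Nat.card F) K r * (∑ L ∈ pointsOutside W, p L) ^ K := by
  induction K generalizing r W with
  | zero => simp [relProb_zero, uniformProb]
  | succ K ih =>
    obtain _ | r := r
    · lia
    set A := pointsOutside W with hA
    set x : Submodule F V → ℝ := fun U => ∑ L ∈ A.filter (fun L => W ⊔ L.submodule = U), p L
      with hx
    have hsum : ∑ U ∈ A.image (fun L : ℙ F V => W ⊔ L.submodule), x U = ∑ L ∈ A, p L :=
      Finset.sum_fiberwise_of_maps_to (fun L hL => Finset.mem_image_of_mem _ hL) p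
    have hcompl : ∀ L ∈ A, ∑ L' ∈ pointsOutside (W ⊔ L.submodule), p L' =
        ∑ L' ∈ A, p L' - x (W ⊔ L.submodule) := fun L hL => by
      rw [hx, ← Finset.sum_sdiff (pointsOutside_sup_subset W L.submodule)]
      simp only [hA, filter_sup_submodule_eq hL, add_sub_cancel_left]
    calc relProb (K + 1) W p
        ≤ ∑ L ∈ A, p L * (uniformProb (Nat.card F) K r *
            (∑ L' ∈ A, p L' - x (W ⊔ L.submodule)) ^ K) := by
          rw [relProb_succ]
          refine Finset.sum_le_sum fun L hL => mul_le_mul_of_nonneg_left ?_ (hp L)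
          rw [← hcompl L hL]
          refine ih (by lia) ?_
          rw [finrank_sup_submodule (Finset.mem_filter.1 hL).2]
          lia
      _ = uniformProb (Nat.card F) K r * ∑ U ∈ A.image (fun L : ℙ F V => W ⊔ L.submodule),
            x U * (∑ U ∈ A.image (fun L : ℙ F V => W ⊔ L.submodule), x U - x U) ^ K := by
          rw [hsum, ← Finset.sum_fiberwise_of_maps_to
            (fun L hL => Finset.mem_image_of_mem (fun L : ℙ F V => W ⊔ L.submodule) hL),
            Finset.mul_sum]
          refine Finset.sum_congr rfl fun U _ => ?_
          rw [hx, Finset.sum_mul, Finset.mul_sum]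
          refine Finset.sum_congr rfl fun L hL => ?_
          rw [(Finset.mem_filter.1 hL).2]
          ring
      _ ≤ uniformProb (Nat.card F) K r *
            ((1 - ((∑ i ∈ Finset.range (r + 1), Nat.card F ^ i : ℕ) : ℝ)⁻¹) ^ K *
              (∑ U ∈ A.image (fun L : ℙ F V => W ⊔ L.submodule), x U) ^ (K + 1)) :=
          mul_le_mul_of_nonneg_left
            (sum_mul_sub_pow_le (hK.trans (le_sum_range_pow Nat.card_pos _))
              (card_image_sup_submodule h) fun U _ => Finset.sum_nonneg fun L _ => hp L)
            (uniformProb_pos Nat.card_pos (by lia)).le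
      _ = _ := by
          rw [hsum, uniformProb, Nat.add_sub_cancel, mul_assoc]

theorem relProb_const [Finite F] {K r : ℕ} (hK : K ≤ r) {W : Submodule F V} (t : ℝ)
    (h : Module.finrank F W + r = Module.finrank F V) :
    relProb K W (fun _ => t) =
      uniformProb (Nat.card F) K r * ((pointsOutside W).card * t) ^ K := by
  induction K generalizing r W with
  | zero => simp [relProb_zero, uniformProb]
  | succ K ih =>
    obtain _ | r := r
    · lia
    have hM : ((∑ i ∈ Finset.range (r + 1), Nat.card F ^ i : ℕ) : ℝ) ≠ 0 := by
      have := le_sum_range_pow (q := Nat.card F) Nat.card_pos (r + 1)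
      exact Nat.cast_ne_zero.2 (by lia)
    have hcard : ∀ L ∈ pointsOutside W, ((pointsOutside (W ⊔ L.submodule)).card : ℝ) =
        (pointsOutside W).card *
          (1 - ((∑ i ∈ Finset.range (r + 1), Nat.card F ^ i : ℕ) : ℝ)⁻¹) := fun L hL => by
      have h₁ := congrArg (Nat.cast (R := ℝ)) (card_pointsOutside_succ h hL)
      have h₂ := congrArg (Nat.cast (R := ℝ)) (card_pointsOutside h)
      rw [Nat.cast_add] at h₁
      rw [Nat.cast_mul] at h₂
      rw [mul_sub, mul_one, h₂, mul_inv_cancel_right₀ hM, ← h₂, h₁, add_sub_cancel_right]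
    have hterm : ∀ L ∈ pointsOutside W, t * relProb K (W ⊔ L.submodule) (fun _ => t) =
        t * (uniformProb (Nat.card F) K r * ((pointsOutside W).card *
          (1 - ((∑ i ∈ Finset.range (r + 1), Nat.card F ^ i : ℕ) : ℝ)⁻¹) * t) ^ K) :=
      fun L hL => by
        rw [← hcard L hL, ih (by lia) (r := r)]
        rw [finrank_sup_submodule (Finset.mem_filter.1 hL).2]
        lia
    rw [relProb_succ, Finset.sum_congr rfl hterm, Finset.sum_const, nsmul_eq_mul, uniformProb,
      Nat.add_sub_cancel]
    simp only [mul_pow]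
    ring

theorem relProb_bot_stability [Finite F] {n : ℕ} (hn : n + 2 ≤ Module.finrank F V) {m : ℕ}
    (hm : m = Fintype.card (ℙ F V)) {p : ℙ F V → ℝ} (hp : ∀ L, 0 ≤ p L) (hsum : ∑ L, p L = 1) :
    uniformProb (Nat.card F) (n + 1) (Module.finrank F V - 1) * stabilityConst n m *
        ∑ L, (p L - (m : ℝ)⁻¹) ^ 2 ≤
      relProb (n + 2) (⊥ : Submodule F V) (fun _ => (m : ℝ)⁻¹) -
        relProb (n + 2) (⊥ : Submodule F V) p := by
  have hg : m = ∑ i ∈ Finset.range (Module.finrank F V), Nat.card F ^ i := by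
    rw [hm, ← Nat.card_eq_fintype_card, Projectivization.card_of_finrank F V rfl]
  have hnm : n + 2 ≤ m := hg ▸ hn.trans (le_sum_range_pow Nat.card_pos _)
  have hm₀ : (m : ℝ) ≠ 0 := Nat.cast_ne_zero.2 (by lia)
  have hpos := uniformProb_pos (q := Nat.card F) Nat.card_pos
    (show n + 1 ≤ Module.finrank F V - 1 by lia)
  have huniform : relProb (n + 2) (⊥ : Submodule F V) (fun _ => (m : ℝ)⁻¹) =
      uniformProb (Nat.card F) (n + 1) (Module.finrank F V - 1) *
        (1 - (m : ℝ)⁻¹) ^ (n + 1) := by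
    rw [relProb_const hn _ (by rw [finrank_bot, zero_add]), pointsOutside_bot, Finset.card_univ,
      ← hm, mul_inv_cancel₀ hm₀, one_pow, mul_one, uniformProb, ← hg]
  have hle : relProb (n + 2) (⊥ : Submodule F V) p ≤
      uniformProb (Nat.card F) (n + 1) (Module.finrank F V - 1) *
        ∑ L, p L * (1 - p L) ^ (n + 1) := by
    rw [relProb_succ, pointsOutside_bot, Finset.mul_sum]
    refine Finset.sum_le_sum fun L _ => ?_
    rw [mul_left_comm, bot_sup_eq]
    refine mul_le_mul_of_nonneg_left ?_ (hp L)
    have := relProb_le (K := n + 1) (r := Module.finrank F V - 1) (W := L.submodule) (by lia) hp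
      (by rw [L.finrank_submodule]; lia)
    rwa [pointsOutside_submodule, Finset.sum_erase_eq_sub (Finset.mem_univ L), hsum] at this
  have hstab := mul_le_mul_of_nonneg_left
    (sum_mul_pow_le_sub hnm (s := Finset.univ) (x := p) (by rw [hm, Finset.card_univ])
      (fun L _ => hp L) hsum) hpos.le
  rw [huniform]
  linear_combination hle + hstab

end Geometry

/-- **Uniqueness and global quadratic stability for projective geometries.** For
`2 ≤ K ≤ N`, there is a constant `c > 0` such that
`F_K(u) − F_K(p) ≥ c·‖p − u‖₂²` for every distribution `p` on `PG(N−1, q)`;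
consequently the uniform distribution `u` is the unique maximizer of `F_K`. -/
theorem projProb_global_quadratic_stability (F : Type*) [Field F] [Fintype F]
    (N K : ℕ) (hN : 2 ≤ N) (hK : 2 ≤ K) (hKN : K ≤ N)
    (m : ℕ) (hm : m = Fintype.card (ℙ F (Fin N → F)))
    (u : ℙ F (Fin N → F) → ℝ) (hu : u = fun _ => (m : ℝ)⁻¹) :
    (∃ c > (0 : ℝ), ∀ p : ℙ F (Fin N → F) → ℝ, (∀ L, 0 ≤ p L) → (∑ L, p L = 1) →
        projProb F N K u - projProb F N K p ≥ c * ∑ L, (p L - u L) ^ 2) ∧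
    (∀ p : ℙ F (Fin N → F) → ℝ, (∀ L, 0 ≤ p L) → (∑ L, p L = 1) → p ≠ u →
        projProb F N K p < projProb F N K u) := by
  obtain ⟨n, rfl⟩ : ∃ n, K = n + 2 := ⟨K - 2, by lia⟩
  have hrank : n + 2 ≤ Module.finrank F (Fin N → F) := by rwa [Module.finrank_fin_fun]
  have hnm : n + 2 ≤ m := by
    rw [hm, ← Nat.card_eq_fintype_card, Projectivization.card_of_finrank F (Fin N → F) rfl]
    exact hrank.trans (le_sum_range_pow Nat.card_pos _)
  have hc : 0 < uniformProb (Nat.card F) (n + 1) (Module.finrank F (Fin N → F) - 1) *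
      stabilityConst n m :=
    mul_pos (uniformProb_pos Nat.card_pos (by lia)) (stabilityConst_pos hnm)
  subst hu
  simp_rw [projProb_eq_relProb]
  refine ⟨⟨_, hc, fun p hp hsum => relProb_bot_stability hrank hm hp hsum⟩,
    fun p hp hsum hne => ?_⟩
  obtain ⟨L, hL⟩ := Function.ne_iff.1 hne
  have hdist : 0 < ∑ L, (p L - (m : ℝ)⁻¹) ^ 2 :=
    Finset.sum_pos' (fun _ _ => sq_nonneg _)
      ⟨L, Finset.mem_univ L, sq_pos_of_ne_zero (sub_ne_zero.2 hL)⟩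
  linarith [relProb_bot_stability hrank hm hp hsum, mul_pos hc hdist]
end

section
/- Let q be a prime power, N ≥ 2, and 2 ≤ K ≤ N. Let E = PG(N−1, q), m = |E| = (q^N−1)/(q−1), u the uniform distribution on E, and f(x) = Σ_{S independent, |S| = K} Π_{L ∈ S} x_L the degree-K independent-set generating polynomial. Let B_2 > 0 be the number of K-element independent subsets containing any two fixed distinct projective points. Then for every vector v ∈ ℝ^E with Σ_{L ∈ E} v_L = 0, the Hessian quadratic form of f at u satisfies vᵀ ∇²f(u) v = −B_2 · m^{−(K−2)} · ‖v‖_2². -/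
open Finset Classical
open scoped LinearAlgebra.Projectivization

/-- The degree-`K` independent-set generating polynomial of the projective geometry:
`f(x) = ∑_{S independent, |S| = K} ∏_{L ∈ S} x_L`. -/
noncomputable def projGenPoly (F : Type*) [Field F] [Fintype F] (N K : ℕ)
    (x : ℙ F (Fin N → F) → ℝ) : ℝ :=
  ∑ S ∈ Finset.univ.powersetCard K, if ProjIndep F N S then ∏ L ∈ S, x L else 0

/-- The number of `K`-element independent subsets of `PG(N−1, q)` containing both of
two fixed projective points `e` and `e'`. -/
noncomputable def pairIndepCount (F : Type*) [Field F] [Fintype F] (N K : ℕ)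
    (e e' : ℙ F (Fin N → F)) : ℕ :=
  ((Finset.univ.powersetCard K).filter
    (fun S => e ∈ S ∧ e' ∈ S ∧ ProjIndep F N S)).card

/-- The partial derivative of a sum of squarefree monomials. -/
theorem fderiv_sum_prod_apply_single {E ι : Type*} [Fintype E] (A : Finset ι)
    (g : ι → Finset E) (x : E → ℝ) (i : E) :
    fderiv ℝ (fun x : E → ℝ => ∑ a ∈ A, ∏ L ∈ g a, x L) x (Pi.single i 1) =
      ∑ a ∈ A with i ∈ g a, ∏ L ∈ (g a).erase i, x L := by
  have h : HasFDerivAt (fun x : E → ℝ => ∑ a ∈ A, ∏ L ∈ g a, x L)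
      (∑ a ∈ A, ∑ i ∈ g a, (∏ j ∈ (g a).erase i, x j) •
        (ContinuousLinearMap.proj i : (E → ℝ) →L[ℝ] ℝ)) x :=
    HasFDerivAt.fun_sum fun a _ => hasFDerivAt_finsetProd
  rw [h.fderiv, Finset.sum_filter]
  simp [Pi.single_apply]

/-- The mixed second partial derivatives of a `K`-homogeneous sum of squarefree monomials at a
constant vector. -/
theorem fderiv_fderiv_sum_prod_const {E : Type*} [Fintype E] (A : Finset (Finset E)) {K : ℕ}
    (hA : ∀ S ∈ A, S.card = K) (c : ℝ) (i j : E) :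
    fderiv ℝ (fun x => fderiv ℝ (fun x : E → ℝ => ∑ S ∈ A, ∏ L ∈ S, x L) x (Pi.single j 1))
        (fun _ => c) (Pi.single i 1) =
      if i = j then 0 else ({S ∈ A | i ∈ S ∧ j ∈ S}.card : ℝ) * c ^ (K - 2) := by
  rw [funext fun x => fderiv_sum_prod_apply_single A (fun S => S) x j]
  rw [fderiv_sum_prod_apply_single, Finset.filter_filter]
  split_ifs with hij
  · subst hij
    simp
  · rw [← nsmul_eq_mul, ← Finset.sum_const]
    refine Finset.sum_congr (by ext S; simp [hij]; tauto) fun S hS => ?_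
    simp only [Finset.mem_filter] at hS
    rw [Finset.prod_const, Finset.card_erase_of_mem (by simp [hij, hS]),
      Finset.card_erase_of_mem hS.2.2, hA S hS.1, Nat.sub_sub]

theorem Projectivization.Independent.linearEquiv_smul {ι F V : Type*} [Field F] [AddCommGroup V]
    [Module F V] {f : ι → ℙ F V} (hf : Projectivization.Independent f) (g : V ≃ₗ[F] V) :
    Projectivization.Independent fun i => g • f i := by
  obtain ⟨f, hf, hl⟩ := hf
  exact .mk (fun i => g (f i)) (fun i => by simpa using hf i)
    (hl.map' g.toLinearMap g.ker)

theorem ProjIndep.linearEquiv_map {F : Type*} [Field F] [Fintype F] {N : ℕ}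
    {S : Finset (ℙ F (Fin N → F))} (hS : ProjIndep F N S) (g : (Fin N → F) ≃ₗ[F] (Fin N → F)) :
    ProjIndep F N (S.map (MulAction.toPerm g).toEmbedding) := by
  have h := Projectivization.independent_iff.1 (hS.linearEquiv_smul g)
  refine Projectivization.independent_iff.2 ?_
  have h' := h.comp (fun x : {x // x ∈ S.map (MulAction.toPerm g).toEmbedding} =>
    (⟨g⁻¹ • x.1, by
      obtain ⟨y, hy, hyx⟩ := Finset.mem_map.1 x.2
      simpa [← hyx] using hy⟩ : {x // x ∈ S})) fun x y hxy => by
        exact Subtype.ext (smul_left_cancel g⁻¹ (congrArg Subtype.val hxy))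
  convert! h' using 1
  ext1 x
  simp only [Function.comp_apply, smul_inv_smul]

section

variable (F : Type*) [Field F] [Fintype F] (N K : ℕ)

theorem pairIndepCount_le_smul (g : (Fin N → F) ≃ₗ[F] (Fin N → F)) (a b : ℙ F (Fin N → F)) :
    pairIndepCount F N K a b ≤ pairIndepCount F N K (g • a) (g • b) := by
  refine Finset.card_le_card_of_injOn (fun S => S.map (MulAction.toPerm g).toEmbedding) ?_
    (Finset.map_injective _).injOn
  intro S hS
  simp only [Finset.coe_filter, Set.mem_ofPred_eq, Finset.mem_powersetCard_univ] at hS ⊢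
  obtain ⟨hK, ha, hb, hS⟩ := hS
  exact ⟨by simpa using hK, Finset.mem_map_of_mem _ ha, Finset.mem_map_of_mem _ hb,
    hS.linearEquiv_map g⟩

/-- The number of independent `K`-sets through two distinct points does not depend on the
points. -/
theorem pairIndepCount_eq_of_ne {a b c d : ℙ F (Fin N → F)} (hab : a ≠ b) (hcd : c ≠ d) :
    pairIndepCount F N K a b = pairIndepCount F N K c d := by
  have key {a b c d : ℙ F (Fin N → F)} (hab : a ≠ b) (hcd : c ≠ d) :
      pairIndepCount F N K a b ≤ pairIndepCount F N K c d := by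
    obtain ⟨g, rfl, rfl⟩ := (MulAction.is_two_pretransitive_iff
      (G := (Fin N → F) ≃ₗ[F] (Fin N → F))).1 inferInstance hab hcd
    exact pairIndepCount_le_smul F N K g a b
  exact (key hab hcd).antisymm (key hcd hab)

theorem projGenPoly_eq_sum_filter :
    projGenPoly F N K =
      fun x => ∑ S ∈ Finset.univ.powersetCard K with ProjIndep F N S, ∏ L ∈ S, x L := by
  ext x
  rw [projGenPoly, Finset.sum_filter]

end

/-- The off-diagonal part of `(∑ v)²` for a vector with zero sum. -/
theorem sum_sum_mul_ite_of_sum_eq_zero {E : Type*} [Fintype E] (v : E → ℝ) (hv : ∑ i, v i = 0)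
    (c : ℝ) : ∑ i, ∑ j, v i * v j * (if i = j then 0 else c) = -c * ∑ i, v i ^ 2 := by
  have h (i j : E) : v i * v j * (if i = j then 0 else c) =
      c * v i * v j - if i = j then c * v i ^ 2 else 0 := by
    split_ifs with hij
    · subst hij; ring
    · ring
  simp_rw [h, Finset.sum_sub_distrib, ← Finset.mul_sum, hv]
  simp [Finset.mul_sum]

/-- **The Hessian quadratic form at the uniform distribution.** For `2 ≤ K ≤ N`, with
`B₂` the number of `K`-element independent sets through two fixed distinct points and
`u` the uniform distribution, for every `v` with `∑_L v_L = 0` one has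
`vᵀ ∇²f(u) v = −B₂ · m^{−(K−2)} · ‖v‖₂²`. -/
theorem projGenPoly_hessian_at_uniform (F : Type*) [Field F] [Fintype F]
    (N K : ℕ) (hN : 2 ≤ N) (hK : 2 ≤ K) (hKN : K ≤ N)
    (m : ℕ) (hm : m = Fintype.card (ℙ F (Fin N → F)))
    (u : ℙ F (Fin N → F) → ℝ) (hu : u = fun _ => (m : ℝ)⁻¹)
    (e e' : ℙ F (Fin N → F)) (he : e ≠ e') (B₂ : ℕ)
    (hB : B₂ = pairIndepCount F N K e e') (hBpos : 0 < B₂)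
    (v : ℙ F (Fin N → F) → ℝ) (hv : ∑ L, v L = 0) :
    (∑ L, ∑ L', v L * v L' *
        fderiv ℝ (fun x => fderiv ℝ (projGenPoly F N K) x (Pi.single L' 1)) u
          (Pi.single L 1))
      = -(B₂ : ℝ) * (m : ℝ) ^ (-((K : ℤ) - 2)) * ∑ L, v L ^ 2 := by
  subst hm hu hB
  have hess (L L' : ℙ F (Fin N → F)) :
      fderiv ℝ (fun x => fderiv ℝ (projGenPoly F N K) x (Pi.single L' 1))
          (fun _ => (Fintype.card (ℙ F (Fin N → F)) : ℝ)⁻¹) (Pi.single L 1) =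
        if L = L' then 0 else (pairIndepCount F N K e e' : ℝ) *
          (Fintype.card (ℙ F (Fin N → F)) : ℝ) ^ (-((K : ℤ) - 2)) := by
    rw [projGenPoly_eq_sum_filter, fderiv_fderiv_sum_prod_const (K := K) _
      (fun S hS => Finset.mem_powersetCard_univ.1 (Finset.mem_filter.1 hS).1)]
    split_ifs with hLL
    · rfl
    · rw [pairIndepCount_eq_of_ne F N K he hLL, pairIndepCount, Finset.filter_filter, zpow_neg,
        inv_pow, ← zpow_natCast, Nat.cast_sub hK, Nat.cast_ofNat]
      congr 3
      exact Finset.filter_congr fun S _ => ⟨fun h => ⟨h.2.1, h.2.2, h.1⟩, fun h => ⟨h.2.2, h.1, h.2.1⟩⟩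
  simp_rw [hess]
  rw [sum_sum_mul_ite_of_sum_eq_zero v hv, neg_mul (pairIndepCount F N K e e' : ℝ)]
end

section
/- Let M be a matroid on a finite ground set E, let K be an integer with 1 ≤ K ≤ rank(M), and suppose that Aut(M) acts transitively on E. For a probability distribution p on E let f_{M,K}(p) = Σ_{S independent in M, |S| = K} Π_{e ∈ S} p_e. Then for every probability distribution p on E, f_{M,K}(p) ≤ f_{M,K}(u) = |{S ∈ I(M) : |S| = K}| / |E|^K, where u is the uniform distribution on E; that is, among all probability distributions on E, the uniform distribution maximizes f_{M,K}. -/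
open Finset Classical

/-- The degree-`K` independent-set generating polynomial of a matroid `M` on a finite
ground set `α`: `f_{M,K}(x) = ∑_{S ∈ I(M), |S| = K} ∏_{e ∈ S} x_e`. -/
noncomputable def indepGenPoly {α : Type*} [Fintype α] (M : Matroid α) (K : ℕ)
    (x : α → ℝ) : ℝ :=
  ∑ S ∈ Finset.univ.powersetCard K, if M.Indep (S : Set α) then ∏ e ∈ S, x e else 0

open Matrix

/-- Spectral decomposition of the quadratic form of a real symmetric matrix. -/
theorem Matrix.IsSymm.exists_eigenbasis {ι : Type*} [Fintype ι] {B : Matrix ι ι ℝ}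
    (hB : B.IsSymm) : ∃ (w : ι → ι → ℝ) (μ : ι → ℝ),
      (∀ a, w a ⬝ᵥ w a = 1) ∧ (∀ a, B *ᵥ w a = μ a • w a) ∧
      ∀ y, y ⬝ᵥ B *ᵥ y = ∑ a, μ a * (w a ⬝ᵥ y) ^ 2 := by
  have hH : B.IsHermitian := by
    rw [Matrix.IsHermitian, Matrix.conjTranspose_eq_transpose_of_trivial]; exact hB
  refine ⟨fun a => hH.eigenvectorBasis a, hH.eigenvalues, fun a => ?_,
    hH.mulVec_eigenvectorBasis, fun y => ?_⟩
  · have h := hH.eigenvectorBasis.orthonormal.1 a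
    have h2 := real_inner_self_eq_norm_sq (hH.eigenvectorBasis a)
    rw [h, EuclideanSpace.inner_eq_star_dotProduct] at h2
    simpa using h2
  · have h := hH.eigenvectorBasis.sum_inner_mul_inner (WithLp.toLp 2 y) (WithLp.toLp 2 (B *ᵥ y))
    simp only [EuclideanSpace.inner_eq_star_dotProduct, star_trivial] at h
    rw [dotProduct_comm, ← h]
    refine Finset.sum_congr rfl fun a _ => ?_
    have h3 : (B *ᵥ y) ⬝ᵥ (hH.eigenvectorBasis a : ι → ℝ)
        = hH.eigenvalues a * ((hH.eigenvectorBasis a : ι → ℝ) ⬝ᵥ y) := by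
      rw [dotProduct_comm, dotProduct_mulVec, ← mulVec_transpose, hB.eq,
        hH.mulVec_eigenvectorBasis, smul_dotProduct, smul_eq_mul]
    rw [h3]
    ring

/-- A real symmetric nonnegative matrix `H` which is irreducible on its support, and whose
normalization at a positive vector `x` satisfies `A ≤ A²`, is negative semidefinite on the
`H`-orthogonal complement of `x`. -/
theorem Matrix.IsSymm.quadForm_nonpos_of_le_sq {ι : Type*} [Fintype ι] {H : Matrix ι ι ℝ}
    (hH : H.IsSymm) (hnn : ∀ i j, 0 ≤ H i j) {x : ι → ℝ} (hx : ∀ i, 0 < x i)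
    (hconn : ∀ t : ι → ℝ, (∀ i j, 0 < H i j → t i = t j) →
      ∀ i j, (H *ᵥ x) i ≠ 0 → (H *ᵥ x) j ≠ 0 → t i = t j)
    (hle : ∀ v, v ⬝ᵥ H *ᵥ v ≤ ∑ k, x k * (H *ᵥ v) k ^ 2 / (H *ᵥ x) k)
    {z : ι → ℝ} (hz : z ⬝ᵥ H *ᵥ x = 0) : z ⬝ᵥ H *ᵥ z ≤ 0 := by
  set r := H *ᵥ x with hr
  have hr0 : ∀ i, 0 ≤ r i := fun i =>
    Finset.sum_nonneg fun j _ => mul_nonneg (hnn i j) (hx j).le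
  have hzero : ∀ i, r i = 0 → ∀ j, H i j = 0 := by
    intro i hi j
    have h := (Finset.sum_eq_zero_iff_of_nonneg
      (fun j _ => mul_nonneg (hnn i j) (hx j).le)).1 hi j (mem_univ j)
    exact (mul_eq_zero.1 h).resolve_right (hx j).ne'
  set s : ι → ℝ := fun i => √(x i / r i) with hs
  have hs2 : ∀ i, s i ^ 2 = x i / r i := fun i =>
    Real.sq_sqrt (div_nonneg (hx i).le (hr0 i))
  have hspos : ∀ i, r i ≠ 0 → 0 < s i := fun i hi =>
    Real.sqrt_pos.2 (div_pos (hx i) ((hr0 i).lt_of_ne' hi))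
  set B : Matrix ι ι ℝ := Matrix.of fun i j => s i * H i j * s j with hBdef
  have hBs : B.IsSymm := by
    ext i j
    simp only [hBdef, Matrix.transpose_apply, Matrix.of_apply, hH.apply i j]
    ring
  have hBmul : ∀ w, B *ᵥ w = s * (H *ᵥ (s * w)) := by
    intro w
    ext i
    simp only [hBdef, mulVec, dotProduct, Matrix.of_apply, Pi.mul_apply, Finset.mul_sum]
    exact Finset.sum_congr rfl fun j _ => by ring
  obtain ⟨w, μ, hw1, hwμ, hspec⟩ := hBs.exists_eigenbasis
  set y : ι → ℝ := fun i => z i / s i with hy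
  have hzy : z ⬝ᵥ H *ᵥ z = y ⬝ᵥ B *ᵥ y := by
    simp only [hBdef, mulVec, dotProduct, Matrix.of_apply, Finset.mul_sum]
    refine Finset.sum_congr rfl fun i _ => Finset.sum_congr rfl fun j _ => ?_
    by_cases hi : r i = 0
    · simp [hzero i hi j]
    by_cases hj : r j = 0
    · simp [← hH.apply i j, hzero j hj i]
    have h1 := (hspos i hi).ne'
    have h2 := (hspos j hj).ne'
    simp only [hy]
    field_simp
  rw [hzy, hspec]
  refine Finset.sum_nonpos fun a _ => ?_
  by_cases hμ : μ a ≤ 0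
  · exact mul_nonpos_of_nonpos_of_nonneg hμ (sq_nonneg _)
  push Not at hμ
  have hev : ∀ i, s i * (H *ᵥ (s * w a)) i = μ a * w a i := by
    intro i
    have := congrFun (hwμ a) i
    rw [hBmul] at this
    simpa using this
  have hw0 : ∀ i, r i = 0 → w a i = 0 := by
    intro i hi
    have h := hev i
    have hsi : s i = 0 := by simp [hs, hi]
    rw [hsi, zero_mul] at h
    exact (mul_eq_zero.1 h.symm).resolve_left hμ.ne'
  have hform : (s * w a) ⬝ᵥ H *ᵥ (s * w a) = μ a := by
    calc _ = ∑ i, μ a * (w a i * w a i) := by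
          refine Finset.sum_congr rfl fun i _ => ?_
          have := hev i
          simp only [Pi.mul_apply] at this ⊢
          linear_combination w a i * this
      _ = μ a := by
          rw [← Finset.mul_sum]
          exact (congrArg _ (hw1 a)).trans (mul_one _)
  have hsq : ∑ k, x k * (H *ᵥ (s * w a)) k ^ 2 / r k = μ a ^ 2 := by
    calc _ = ∑ i, μ a ^ 2 * (w a i * w a i) := by
          refine Finset.sum_congr rfl fun i _ => ?_
          rw [mul_div_right_comm, ← hs2, ← mul_pow, hev]
          ring
      _ = μ a ^ 2 := by
          rw [← Finset.mul_sum]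
          exact (congrArg _ (hw1 a)).trans (mul_one _)
  have hμ1 : 1 ≤ μ a := by
    have := hle (s * w a)
    rw [hform, hsq] at this
    nlinarith
  set t : ι → ℝ := fun i => s i * w a i / x i with ht
  have hxt : ∀ i, x i * t i = s i * w a i := fun i => mul_div_cancel₀ _ (hx i).ne'
  have hdiag : ∑ i, x i * t i ^ 2 * r i = 1 := by
    rw [← hw1 a]
    refine Finset.sum_congr rfl fun i _ => ?_
    by_cases hi : r i = 0
    · simp [hi, hw0 i hi]
    · have h1 : x i * (x i * t i ^ 2 * r i) = x i * (w a i * w a i) := by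
        have : x i * (x i * t i ^ 2 * r i) = (x i * t i) ^ 2 * r i := by ring
        rw [this, hxt, mul_pow, hs2]
        field_simp
      exact mul_left_cancel₀ (hx i).ne' h1
  have hlap : ∑ i, ∑ j, H i j * (x i * x j) * (t i - t j) ^ 2 = 2 * 1 - 2 * μ a := by
    have e1 : ∑ i, ∑ j, H i j * (x i * x j) * t i ^ 2 = 1 := by
      rw [← hdiag]
      refine Finset.sum_congr rfl fun i _ => ?_
      simp only [hr, mulVec, dotProduct, Finset.mul_sum]
      exact Finset.sum_congr rfl fun j _ => by ring
    have e2 : ∑ i, ∑ j, H i j * (x i * x j) * t j ^ 2 = 1 := by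
      rw [Finset.sum_comm, ← e1]
      refine Finset.sum_congr rfl fun i _ => Finset.sum_congr rfl fun j _ => ?_
      rw [hH.apply i j]
      ring
    have e3 : ∑ i, ∑ j, H i j * ((x i * t i) * (x j * t j)) = μ a := by
      rw [← hform]
      simp only [mulVec, dotProduct, Finset.mul_sum, Pi.mul_apply, hxt]
      exact Finset.sum_congr rfl fun i _ => Finset.sum_congr rfl fun j _ => by ring
    calc _ = ∑ i, ∑ j, (H i j * (x i * x j) * t i ^ 2 + H i j * (x i * x j) * t j ^ 2
            - 2 * (H i j * ((x i * t i) * (x j * t j)))) :=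
          Finset.sum_congr rfl fun i _ => Finset.sum_congr rfl fun j _ => by ring
      _ = _ := by
          simp only [Finset.sum_sub_distrib, Finset.sum_add_distrib, ← Finset.mul_sum, e1, e2, e3]
          ring
  have hterm : ∀ i j, 0 ≤ H i j * (x i * x j) * (t i - t j) ^ 2 := fun i j =>
    mul_nonneg (mul_nonneg (hnn i j) (mul_pos (hx i) (hx j)).le) (sq_nonneg _)
  have hsum0 : ∑ i, ∑ j, H i j * (x i * x j) * (t i - t j) ^ 2 = 0 :=
    le_antisymm (by rw [hlap]; linarith)
      (Finset.sum_nonneg fun i _ => Finset.sum_nonneg fun j _ => hterm i j)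
  have hteq : ∀ i j, 0 < H i j → t i = t j := by
    intro i j hij
    have h1 := (Finset.sum_eq_zero_iff_of_nonneg
      (fun i _ => Finset.sum_nonneg fun j _ => hterm i j)).1 hsum0 i (mem_univ i)
    have h2 := (Finset.sum_eq_zero_iff_of_nonneg (fun j _ => hterm i j)).1 h1 j (mem_univ j)
    have h3 : 0 < H i j * (x i * x j) := mul_pos hij (mul_pos (hx i) (hx j))
    exact sub_eq_zero.1 (pow_eq_zero_iff two_ne_zero |>.1 ((mul_eq_zero.1 h2).resolve_left h3.ne'))
  have hconst := hconn t hteq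
  have hwy : w a ⬝ᵥ y = 0 := by
    by_cases hall : ∀ i, r i = 0
    · exact Finset.sum_eq_zero fun i _ => by simp [hw0 i (hall i)]
    push Not at hall
    obtain ⟨i₀, hi₀⟩ := hall
    have : w a ⬝ᵥ y = t i₀ * (z ⬝ᵥ r) := by
      simp only [dotProduct, Finset.mul_sum]
      refine Finset.sum_congr rfl fun i _ => ?_
      by_cases hi : r i = 0
      · simp [hi, hw0 i hi]
      · rw [hconst i₀ i hi₀ hi]
        have h1 := (hspos i hi).ne'
        have h2 := hs2 i
        have h3 := (hx i).ne'
        simp only [ht, hy]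
        rw [eq_div_iff hi] at h2
        field_simp
        rw [← h2]
        ring
    rw [this, hz, mul_zero]
  rw [hwy]
  simp

/-- A symmetric bilinear form which is nonpositive on a hyperplane `ker ℓ` satisfies the reversed
Cauchy–Schwarz inequality at every vector of positive square outside that hyperplane. -/
theorem Matrix.IsSymm.quadForm_mul_le_sq {ι : Type*} [Fintype ι] {H : Matrix ι ι ℝ}
    (hH : H.IsSymm) (l : ι → ℝ) (hl : ∀ z, z ⬝ᵥ l = 0 → z ⬝ᵥ H *ᵥ z ≤ 0)
    {y : ι → ℝ} (hly : y ⬝ᵥ l ≠ 0) (hy : 0 < y ⬝ᵥ H *ᵥ y) (v : ι → ℝ) :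
    (v ⬝ᵥ H *ᵥ v) * (y ⬝ᵥ H *ᵥ y) ≤ (v ⬝ᵥ H *ᵥ y) ^ 2 := by
  have hsymm : y ⬝ᵥ H *ᵥ v = v ⬝ᵥ H *ᵥ y := by
    rw [dotProduct_comm, dotProduct_mulVec v, ← mulVec_transpose, hH.eq]
  have h := hl ((v ⬝ᵥ l) • y - (y ⬝ᵥ l) • v) (by
    simp only [sub_dotProduct, smul_dotProduct, smul_eq_mul]; ring)
  simp only [mulVec_sub, mulVec_smul, sub_dotProduct, dotProduct_sub, smul_dotProduct,
    dotProduct_smul, smul_eq_mul, hsymm] at h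
  set a := v ⬝ᵥ l
  set b := y ⬝ᵥ l
  set Y := y ⬝ᵥ H *ᵥ y
  set V := v ⬝ᵥ H *ᵥ v
  set C := v ⬝ᵥ H *ᵥ y
  have hb : 0 < b ^ 2 := by positivity
  have h2 : b ^ 2 * (V * Y - C ^ 2) ≤ 0 := by
    nlinarith [sq_nonneg (a * Y - b * C), mul_le_mul_of_nonneg_left h hy.le]
  nlinarith [nonpos_of_mul_nonpos_right h2 hb]

/-- The form `∑ a i * a j` over pairs in a common fibre is nonnegative. -/
theorem sum_sum_ite_eq_nonneg {ι κ : Type*} [Fintype ι] (c : ι → κ) (a : ι → ℝ) :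
    0 ≤ ∑ i, ∑ j, if c i = c j then a i * a j else 0 := by
  have : ∑ i, ∑ j, (if c i = c j then a i * a j else 0)
      = ∑ X ∈ univ.image c, (∑ i, if c i = X then a i else 0) ^ 2 := by
    simp only [sq, Finset.sum_mul_sum]
    symm
    rw [Finset.sum_comm]
    refine Finset.sum_congr rfl fun i _ => ?_
    rw [Finset.sum_comm]
    refine Finset.sum_congr rfl fun j _ => ?_
    rw [Finset.sum_eq_single_of_mem (c i) (mem_image_of_mem c (mem_univ i))]
    · by_cases h : c i = c j
      · simp [h]
      · simp [h, Ne.symm h]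
    · intro X _ hX
      simp [Ne.symm hX]
  rw [this]
  exact Finset.sum_nonneg fun _ _ => sq_nonneg _

/-- A multiset is independent in a matroid if it has no repetitions and its underlying set is
independent. -/
def Matroid.MultisetIndep {α : Type*} (M : Matroid α) (m : Multiset α) : Prop :=
  m.Nodup ∧ M.Indep {e | e ∈ m}

/-- The mixed independent-set polynomial of a list `L` of weight vectors in the link of `m`: the
sum over all tuples completing `m` to an independent multiset of the product of weights. -/
noncomputable def Matroid.mixedIndep {α : Type*} [Fintype α] (M : Matroid α) :
    List (α → ℝ) → Multiset α → ℝ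
  | [], m => if M.MultisetIndep m then 1 else 0
  | x :: L, m => ∑ k, x k * M.mixedIndep L (k ::ₘ m)

namespace Matroid

variable {α : Type*} {M : Matroid α}

theorem setOf_mem_cons (i : α) (m : Multiset α) :
    {e | e ∈ i ::ₘ m} = insert i {e | e ∈ m} := by
  ext e; simp

theorem multisetIndep_cons (hE : M.E = Set.univ) {i : α} {m : Multiset α} :
    M.MultisetIndep (i ::ₘ m) ↔ M.MultisetIndep m ∧ i ∉ M.closure {e | e ∈ m} := by
  unfold MultisetIndep
  rw [setOf_mem_cons, Multiset.nodup_cons]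
  constructor
  · rintro ⟨⟨him, hm⟩, hI⟩
    have hI' := hI.subset (Set.subset_insert _ _)
    exact ⟨⟨hm, hI'⟩, ((hI'.insert_indep_iff_of_notMem him).1 hI).2⟩
  · rintro ⟨⟨hm, hI⟩, hi⟩
    have him : i ∉ {e | e ∈ m} := fun h =>
      hi (M.subset_closure _ (by rw [hE]; exact Set.subset_univ _) h)
    exact ⟨⟨him, hm⟩, (hI.insert_indep_iff_of_notMem him).2 ⟨by simp [hE], hi⟩⟩

theorem MultisetIndep.of_cons {i : α} {m : Multiset α} (h : M.MultisetIndep (i ::ₘ m)) :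
    M.MultisetIndep m :=
  ⟨(Multiset.nodup_cons.1 h.1).2, h.2.subset fun _ he => Multiset.mem_cons_of_mem he⟩

theorem MultisetIndep.exists_cons {m : Multiset α} (hm : M.MultisetIndep m) {J : Finset α}
    (hJ : M.Indep (J : Set α)) (h : m.card < J.card) : ∃ k, M.MultisetIndep (k ::ₘ m) := by
  have hset : {e | e ∈ m} = ((⟨m, hm.1⟩ : Finset α) : Set α) := rfl
  obtain ⟨k, hk, hI⟩ := hm.2.augment hJ (by
    rw [hset, Set.encard_coe_eq_coe_finsetCard, Set.encard_coe_eq_coe_finsetCard]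
    exact_mod_cast h)
  exact ⟨k, Multiset.nodup_cons.2 ⟨hk.2, hm.1⟩, by rwa [setOf_mem_cons]⟩

/-- In the link of an independent set, non-adjacent elements have the same closure. -/
theorem multisetIndep_cons_cons (hE : M.E = Set.univ) {i j : α} {m : Multiset α}
    (hi : M.MultisetIndep (i ::ₘ m)) (hj : M.MultisetIndep (j ::ₘ m)) :
    M.MultisetIndep (i ::ₘ j ::ₘ m) ↔
      M.closure {e | e ∈ i ::ₘ m} ≠ M.closure {e | e ∈ j ::ₘ m} := by
  rw [multisetIndep_cons hE, and_iff_right hj]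
  refine not_congr ⟨fun h => ?_, fun h => ?_⟩
  · rw [setOf_mem_cons] at h ⊢
    rw [setOf_mem_cons]
    exact M.closure_insert_congr ⟨h, ((multisetIndep_cons hE).1 hi).2⟩
  · rw [← h]
    exact M.subset_closure _ (by rw [hE]; exact Set.subset_univ _) (Multiset.mem_cons_self i m)

variable [Fintype α]

theorem mixedIndep_cons (x : α → ℝ) (L : List (α → ℝ)) (m : Multiset α) :
    M.mixedIndep (x :: L) m = ∑ k, x k * M.mixedIndep L (k ::ₘ m) := rfl

theorem mixedIndep_swap (x y : α → ℝ) (L : List (α → ℝ)) (m : Multiset α) :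
    M.mixedIndep (x :: y :: L) m = M.mixedIndep (y :: x :: L) m := by
  simp only [mixedIndep_cons, Finset.mul_sum]
  rw [Finset.sum_comm]
  refine Finset.sum_congr rfl fun i _ => Finset.sum_congr rfl fun j _ => ?_
  rw [Multiset.cons_swap]
  ring

theorem mixedIndep_perm {L L' : List (α → ℝ)} (h : L.Perm L') (m : Multiset α) :
    M.mixedIndep L m = M.mixedIndep L' m := by
  induction h generalizing m with
  | nil => rfl
  | cons x _ ih => simp only [mixedIndep_cons, ih]
  | swap x y L => exact mixedIndep_swap _ _ _ _
  | trans _ _ ih1 ih2 => rw [ih1, ih2]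

theorem mixedIndep_eq_zero {m : Multiset α} (hm : ¬ M.MultisetIndep m) (L : List (α → ℝ)) :
    M.mixedIndep L m = 0 := by
  induction L generalizing m with
  | nil => exact if_neg hm
  | cons x L ih =>
    exact Finset.sum_eq_zero fun k _ => by rw [ih fun h => hm h.of_cons, mul_zero]

theorem mixedIndep_nonneg {L : List (α → ℝ)} (hL : ∀ x ∈ L, ∀ i, 0 < x i) (m : Multiset α) :
    0 ≤ M.mixedIndep L m := by
  induction L generalizing m with
  | nil => unfold mixedIndep; split_ifs <;> norm_num
  | cons x L ih =>
    exact Finset.sum_nonneg fun k _ => mul_nonneg (hL x List.mem_cons_self k).le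
      (ih (fun y hy => hL y (List.mem_cons_of_mem _ hy)) _)

theorem mixedIndep_pos {J : Finset α} (hJ : M.Indep (J : Set α)) {L : List (α → ℝ)}
    (hL : ∀ x ∈ L, ∀ i, 0 < x i) {m : Multiset α} (hm : M.MultisetIndep m)
    (hcard : m.card + L.length ≤ J.card) : 0 < M.mixedIndep L m := by
  induction L generalizing m with
  | nil => unfold mixedIndep; rw [if_pos hm]; exact one_pos
  | cons x L ih =>
    rw [List.length_cons] at hcard
    have hL' : ∀ y ∈ L, ∀ i, 0 < y i := fun y hy => hL y (List.mem_cons_of_mem _ hy)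
    have hx := hL x List.mem_cons_self
    obtain ⟨k, hk⟩ := hm.exists_cons hJ (by omega)
    refine Finset.sum_pos' (fun k _ => mul_nonneg (hx k).le (mixedIndep_nonneg hL' _))
      ⟨k, mem_univ k, mul_pos (hx k) (ih hL' hk ?_)⟩
    rw [Multiset.card_cons]
    omega

/-- The Hessian of the mixed independent-set polynomial. -/
noncomputable def mixedHessian (M : Matroid α) (L : List (α → ℝ)) (m : Multiset α) :
    Matrix α α ℝ :=
  Matrix.of fun i j => M.mixedIndep L (i ::ₘ j ::ₘ m)

theorem mixedHessian_isSymm (L : List (α → ℝ)) (m : Multiset α) :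
    (M.mixedHessian L m).IsSymm := by
  ext i j
  simp only [mixedHessian, Matrix.transpose_apply, Matrix.of_apply]
  rw [Multiset.cons_swap]

theorem mixedHessian_mulVec (L : List (α → ℝ)) (m : Multiset α) (v : α → ℝ) (i : α) :
    (M.mixedHessian L m *ᵥ v) i = M.mixedIndep (v :: L) (i ::ₘ m) := by
  simp only [mixedHessian, mulVec, dotProduct, Matrix.of_apply, mixedIndep_cons]
  refine Finset.sum_congr rfl fun j _ => ?_
  rw [Multiset.cons_swap, mul_comm]

theorem dotProduct_mixedHessian_mulVec (L : List (α → ℝ)) (m : Multiset α) (v w : α → ℝ) :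
    v ⬝ᵥ M.mixedHessian L m *ᵥ w = M.mixedIndep (v :: w :: L) m := by
  simp only [dotProduct, mixedHessian_mulVec]
  rfl

theorem mixedHessian_nil_quadForm_nonpos (hE : M.E = Set.univ) {m : Multiset α} {z : α → ℝ}
    (hz : z ⬝ᵥ (fun i => M.mixedIndep [] (i ::ₘ m)) = 0) :
    z ⬝ᵥ M.mixedHessian [] m *ᵥ z ≤ 0 := by
  set a : α → ℝ := fun i => z i * M.mixedIndep [] (i ::ₘ m) with ha
  have hsum : ∑ i, a i = 0 := hz
  have hnonneg := sum_sum_ite_eq_nonneg (fun i => M.closure {e | e ∈ i ::ₘ m}) a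
  have key : z ⬝ᵥ M.mixedHessian [] m *ᵥ z = (∑ i, a i) * (∑ j, a j) -
      ∑ i, ∑ j, if M.closure {e | e ∈ i ::ₘ m} = M.closure {e | e ∈ j ::ₘ m}
        then a i * a j else 0 := by
    rw [Finset.sum_mul_sum, ← Finset.sum_sub_distrib]
    simp only [dotProduct, mulVec, Finset.mul_sum, ← Finset.sum_sub_distrib]
    refine Finset.sum_congr rfl fun i _ => Finset.sum_congr rfl fun j _ => ?_
    simp only [mixedHessian, Matrix.of_apply, ha]
    by_cases hi : M.MultisetIndep (i ::ₘ m)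
    swap
    · rw [mixedIndep_eq_zero hi, Multiset.cons_swap, mixedIndep_eq_zero fun h => hi h.of_cons]
      simp
    by_cases hj : M.MultisetIndep (j ::ₘ m)
    swap
    · rw [mixedIndep_eq_zero hj, mixedIndep_eq_zero fun h => hj h.of_cons]
      simp
    simp only [mixedIndep, multisetIndep_cons_cons hE hi hj, hi, hj, if_true]
    split_ifs <;> simp_all
  rw [key, hsum, zero_mul, zero_sub, neg_nonpos]
  convert hnonneg

theorem mixedHessian_cons_quadForm_nonpos (hE : M.E = Set.univ) {J : Finset α}
    (hJ : M.Indep (J : Set α)) {x : α → ℝ} {L : List (α → ℝ)} (hx : ∀ i, 0 < x i)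
    (hL : ∀ y ∈ L, ∀ i, 0 < y i) {m : Multiset α} (hcard : m.card + L.length + 3 ≤ J.card)
    (hlink : ∀ k v, M.mixedIndep (v :: v :: L) (k ::ₘ m) * M.mixedIndep (x :: x :: L) (k ::ₘ m) ≤
      M.mixedIndep (v :: x :: L) (k ::ₘ m) ^ 2)
    {z : α → ℝ} (hz : z ⬝ᵥ M.mixedHessian (x :: L) m *ᵥ x = 0) :
    z ⬝ᵥ M.mixedHessian (x :: L) m *ᵥ z ≤ 0 := by
  have hL1 : ∀ y ∈ x :: L, ∀ i, 0 < y i := List.forall_mem_cons.2 ⟨hx, hL⟩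
  have hL2 : ∀ y ∈ x :: x :: L, ∀ i, 0 < y i := List.forall_mem_cons.2 ⟨hx, hL1⟩
  have hentry : ∀ i j, M.MultisetIndep (i ::ₘ j ::ₘ m) → 0 < M.mixedHessian (x :: L) m i j :=
    fun i j h => mixedIndep_pos hJ hL1 h (by simp only [Multiset.card_cons, List.length_cons]; omega)
  have hrow : ∀ i, M.mixedIndep (x :: x :: L) (i ::ₘ m) ≠ 0 → M.MultisetIndep (i ::ₘ m) :=
    fun i h => by_contra fun hi => h (mixedIndep_eq_zero hi _)
  refine (mixedHessian_isSymm (M := M) (x :: L) m).quadForm_nonpos_of_le_sq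
    (fun i j => mixedIndep_nonneg hL1 (i ::ₘ j ::ₘ m)) hx ?_ ?_ hz
  · intro t ht i j hi hj
    rw [mixedHessian_mulVec] at hi hj
    replace hi := hrow i hi
    replace hj := hrow j hj
    by_cases hc : M.closure {e | e ∈ i ::ₘ m} = M.closure {e | e ∈ j ::ₘ m}
    · obtain ⟨k, hk⟩ := hi.exists_cons hJ (by rw [Multiset.card_cons]; omega)
      have hk' : M.MultisetIndep (k ::ₘ m) := by
        rw [Multiset.cons_swap] at hk; exact hk.of_cons
      have hkj : M.MultisetIndep (k ::ₘ j ::ₘ m) := by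
        rw [multisetIndep_cons_cons hE hk' hj, ← hc, ← multisetIndep_cons_cons hE hk' hi]
        exact hk
      rw [← ht k i (hentry k i hk), ← ht k j (hentry k j hkj)]
    · exact ht i j (hentry i j ((multisetIndep_cons_cons hE hi hj).2 hc))
  · intro v
    rw [dotProduct_mixedHessian_mulVec,
      mixedIndep_perm (((List.Perm.swap x v L).cons v).trans (List.Perm.swap x v (v :: L))),
      mixedIndep_cons]
    refine Finset.sum_le_sum fun k _ => ?_
    rw [mixedHessian_mulVec, mixedHessian_mulVec, mul_div_assoc]
    refine mul_le_mul_of_nonneg_left ?_ (hx k).le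
    by_cases hk : M.MultisetIndep (k ::ₘ m)
    · rw [le_div_iff₀ (mixedIndep_pos hJ hL2 hk (by
        simp only [Multiset.card_cons, List.length_cons]; omega))]
      exact hlink k v
    · simp [mixedIndep_eq_zero hk]

/-- Alexandrov–Fenchel type inequality for mixed independent-set polynomials. -/
theorem mixedIndep_mul_le_sq (hE : M.E = Set.univ) {J : Finset α} (hJ : M.Indep (J : Set α))
    {L : List (α → ℝ)} (hL : ∀ x ∈ L, ∀ i, 0 < x i) {m : Multiset α}
    (hcard : m.card + L.length + 2 ≤ J.card) {y : α → ℝ} (hy : ∀ i, 0 < y i) (v : α → ℝ) :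
    M.mixedIndep (v :: v :: L) m * M.mixedIndep (y :: y :: L) m ≤
      M.mixedIndep (v :: y :: L) m ^ 2 := by
  induction L generalizing m y v with
  | nil =>
    by_cases hm : M.MultisetIndep m
    swap
    · simp [mixedIndep_eq_zero hm]
    rw [List.length_nil] at hcard
    simp only [← dotProduct_mixedHessian_mulVec]
    refine (mixedHessian_isSymm _ _).quadForm_mul_le_sq _
      (fun z hz => mixedHessian_nil_quadForm_nonpos hE hz) ?_ ?_ v
    · exact (mixedIndep_pos hJ (L := [y]) (by simpa using hy) hm
        (by simp only [List.length_cons, List.length_nil]; omega)).ne'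
    · rw [dotProduct_mixedHessian_mulVec]
      exact mixedIndep_pos hJ (by simpa using hy) hm
        (by simp only [List.length_cons, List.length_nil]; omega)
  | cons x L ih =>
    by_cases hm : M.MultisetIndep m
    swap
    · simp [mixedIndep_eq_zero hm]
    rw [List.length_cons] at hcard
    obtain ⟨hx, hL⟩ := List.forall_mem_cons.1 hL
    simp only [← dotProduct_mixedHessian_mulVec]
    refine (mixedHessian_isSymm _ _).quadForm_mul_le_sq _
      (fun z hz => mixedHessian_cons_quadForm_nonpos hE hJ hx hL (by omega)
        (fun k v => ih hL (by rw [Multiset.card_cons]; omega) hx v) hz) ?_ ?_ v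
    · rw [dotProduct_mixedHessian_mulVec]
      refine (mixedIndep_pos hJ ?_ hm (by simp only [List.length_cons]; omega)).ne'
      simp only [List.forall_mem_cons]
      exact ⟨hy, hx, hx, hL⟩
    · rw [dotProduct_mixedHessian_mulVec]
      refine mixedIndep_pos hJ ?_ hm (by simp only [List.length_cons]; omega)
      simp only [List.forall_mem_cons]
      exact ⟨hy, hy, hx, hL⟩

/-- Euler's identity: the mixed polynomial at equal arguments is a multiple of the generating
polynomial of the link. -/
theorem mixedIndep_replicate (n : ℕ) (p : α → ℝ) (m : Multiset α) :
    M.mixedIndep (List.replicate n p) m = n.factorial * ∑ T ∈ univ.powersetCard n,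
      if M.MultisetIndep (T.val + m) then ∏ e ∈ T, p e else 0 := by
  induction n generalizing m with
  | zero => simp [mixedIndep]
  | succ n ih =>
    set φ : Finset α → ℝ := fun T => if M.MultisetIndep (T.val + m) then ∏ e ∈ T, p e else 0
    have hstep : ∀ k, ∀ T : Finset α,
        p k * (if M.MultisetIndep (T.val + k ::ₘ m) then ∏ e ∈ T, p e else 0)
          = if k ∉ T then φ (insert k T) else 0 := by
      intro k T
      by_cases hk : k ∈ T
      · rw [if_neg (not_not.2 hk), if_neg, mul_zero]
        rw [Multiset.add_cons]
        exact fun h => (Multiset.nodup_cons.1 h.1).1 (Multiset.mem_add.2 (Or.inl hk))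
      · rw [if_pos hk]
        simp only [φ]
        rw [Finset.insert_val_of_notMem hk, Finset.prod_insert hk, Multiset.add_cons,
          Multiset.cons_add, mul_ite, mul_zero]
    have hcount : ∑ k, ∑ T ∈ univ.powersetCard n, (if k ∉ T then φ (insert k T) else 0)
        = ∑ T ∈ univ.powersetCard (n + 1), ∑ _k ∈ T, φ T := by
      rw [← Finset.sum_product' univ (univ.powersetCard n)
        (fun k T => if k ∉ T then φ (insert k T) else 0), ← Finset.sum_filter, Finset.sum_sigma']
      refine Finset.sum_bij' (fun q _ => ⟨insert q.1 q.2, q.1⟩)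
        (fun q _ => (q.2, q.1.erase q.2)) ?_ ?_ ?_ ?_ ?_
      · rintro ⟨k, T⟩ h
        simp only [mem_filter, mem_product, mem_powersetCard, mem_sigma] at h ⊢
        exact ⟨⟨subset_univ _, by rw [card_insert_of_notMem h.2, h.1.2.2]⟩, mem_insert_self _ _⟩
      · rintro ⟨T, k⟩ h
        simp only [mem_filter, mem_product, mem_powersetCard, mem_sigma] at h ⊢
        exact ⟨⟨mem_univ _, subset_univ _, by rw [card_erase_of_mem h.2, h.1.2]; rfl⟩,
          notMem_erase _ _⟩
      · rintro ⟨k, T⟩ h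
        simp only [mem_filter] at h
        simp [erase_insert h.2]
      · rintro ⟨T, k⟩ h
        simp only [mem_sigma] at h
        simp [insert_erase h.2]
      · rintro ⟨k, T⟩ h
        rfl
    rw [List.replicate_succ, mixedIndep_cons]
    calc _ = (n.factorial : ℝ) * ∑ k, ∑ T ∈ univ.powersetCard n,
            (if k ∉ T then φ (insert k T) else 0) := by
          rw [Finset.mul_sum]
          refine Finset.sum_congr rfl fun k _ => ?_
          rw [ih, mul_left_comm, Finset.mul_sum]
          exact congrArg _ (Finset.sum_congr rfl fun T _ => hstep k T)
      _ = _ := by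
          rw [hcount, Nat.factorial_succ, Nat.cast_mul, mul_comm ((n + 1 : ℕ) : ℝ), mul_assoc]
          congr 1
          rw [Finset.mul_sum]
          refine Finset.sum_congr rfl fun T hT => ?_
          rw [Finset.sum_const, (mem_powersetCard.1 hT).2, nsmul_eq_mul]

theorem mixedIndep_replicate_zero (n : ℕ) (p : α → ℝ) :
    M.mixedIndep (List.replicate n p) 0 = n.factorial * indepGenPoly M n p := by
  rw [mixedIndep_replicate, indepGenPoly]
  congr 1
  refine Finset.sum_congr rfl fun T _ => ?_
  have : M.MultisetIndep (T.val + 0) ↔ M.Indep (T : Set α) := by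
    rw [add_zero]
    exact and_iff_right T.nodup
  simp only [this]

theorem mixedIndep_map (g : α ≃ α) (hg : ∀ S : Set α, M.Indep (g '' S) ↔ M.Indep S)
    {L : List (α → ℝ)} (hL : ∀ x ∈ L, ∀ i, x (g i) = x i) (m : Multiset α) :
    M.mixedIndep L (m.map g) = M.mixedIndep L m := by
  induction L generalizing m with
  | nil =>
    have : M.MultisetIndep (m.map g) ↔ M.MultisetIndep m := by
      refine and_congr (Multiset.nodup_map_iff_of_injective g.injective) ?_
      rw [← hg {e | e ∈ m}]
      have : {e | e ∈ m.map g} = g '' {e | e ∈ m} := Set.ext fun _ => Multiset.mem_map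
      rw [this]
    simp only [mixedIndep, this]
  | cons x L ih =>
    obtain ⟨hx, hL⟩ := List.forall_mem_cons.1 hL
    rw [mixedIndep_cons, mixedIndep_cons, ← Equiv.sum_comp g]
    refine Finset.sum_congr rfl fun k _ => ?_
    rw [hx, ← Multiset.map_cons, ih hL]

/-- For a transitive matroid, replacing one constant argument by another vector of the same total
weight does not change the mixed polynomial. -/
theorem mixedIndep_cons_replicate_const
    (htrans : ∀ e e' : α, ∃ g : α ≃ α, (∀ S : Set α, M.Indep (g '' S) ↔ M.Indep S) ∧ g e = e')
    {p q : α → ℝ} (hpq : ∑ e, p e = ∑ e, q e) (c : ℝ) (n : ℕ) :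
    M.mixedIndep (p :: List.replicate n fun _ => c) 0 =
      M.mixedIndep (q :: List.replicate n fun _ => c) 0 := by
  have hconst : ∀ e e' : α, M.mixedIndep (List.replicate n fun _ => c) (e ::ₘ 0) =
      M.mixedIndep (List.replicate n fun _ => c) (e' ::ₘ 0) := by
    intro e e'
    obtain ⟨g, hg, rfl⟩ := htrans e e'
    rw [← mixedIndep_map g hg (fun x hx i => by rw [List.eq_of_mem_replicate hx]) (e ::ₘ 0)]
    simp
  rw [mixedIndep_cons, mixedIndep_cons]
  rcases isEmpty_or_nonempty α with h | ⟨⟨e₀⟩⟩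
  · simp
  · simp only [hconst _ e₀, ← Finset.sum_mul, hpq]

theorem indepGenPoly_le_const_of_pos (hE : M.E = Set.univ) {K : ℕ}
    (hrank : ∃ I : Finset α, M.Indep (I : Set α) ∧ I.card = K)
    (htrans : ∀ e e' : α, ∃ g : α ≃ α, (∀ S : Set α, M.Indep (g '' S) ↔ M.Indep S) ∧ g e = e')
    {p : α → ℝ} (hp : ∀ e, 0 < p e) {c : ℝ} (hc : 0 < c) (hsum : ∑ e, p e = ∑ _e : α, c) :
    indepGenPoly M K p ≤ indepGenPoly M K fun _ => c := by
  obtain ⟨J, hJ, hJK⟩ := hrank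
  set u : α → ℝ := fun _ => c with hu
  set a : ℕ → ℝ := fun j => M.mixedIndep (List.replicate j p ++ List.replicate (K - j) u) 0
    with ha
  have h0 : M.MultisetIndep 0 := ⟨Multiset.nodup_zero, by simp⟩
  have hmem : ∀ i j, ∀ x ∈ List.replicate i p ++ List.replicate j u, ∀ e, 0 < x e := by
    intro i j x hx e
    rcases List.mem_append.1 hx with h | h
    · rw [List.eq_of_mem_replicate h]; exact hp e
    · rw [List.eq_of_mem_replicate h]; exact hc
  have hpos : ∀ j ≤ K, 0 < a j := fun j hj =>
    mixedIndep_pos hJ (hmem _ _) h0 (by simp; omega)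
  have hlc : ∀ j, j + 2 ≤ K → a (j + 2) * a j ≤ a (j + 1) ^ 2 := by
    intro j hj
    obtain ⟨d, rfl⟩ := Nat.exists_eq_add_of_le hj
    have h := mixedIndep_mul_le_sq hE hJ (hmem j d) (m := 0) (by simp; omega)
      (y := u) (fun _ => hc) p
    have e1 : a (j + 1) = M.mixedIndep (p :: u :: (List.replicate j p ++ List.replicate d u)) 0 := by
      simp only [ha, show j + 2 + d - (j + 1) = d + 1 by omega, List.replicate_succ,
        List.cons_append]
      exact mixedIndep_perm (List.perm_middle.cons p) 0
    have e0 : a j = M.mixedIndep (u :: u :: (List.replicate j p ++ List.replicate d u)) 0 := by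
      simp only [ha, show j + 2 + d - j = d + 1 + 1 by omega, List.replicate_succ]
      exact mixedIndep_perm (List.perm_middle.trans (List.perm_middle.cons u)) 0
    have e2 : a (j + 2) = M.mixedIndep (p :: p :: (List.replicate j p ++ List.replicate d u)) 0 := by
      simp only [ha, show j + 2 + d - (j + 2) = d by omega, List.replicate_succ,
        List.cons_append]
    rw [e0, e1, e2]
    exact h
  have hmono : ∀ j, j + 1 ≤ K → a (j + 1) ≤ a j := by
    intro j
    induction j with
    | zero =>
      intro hj
      obtain ⟨d, rfl⟩ := Nat.exists_eq_add_of_le' hj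
      have := mixedIndep_cons_replicate_const (M := M) htrans hsum c d
      simp only [ha, zero_add, Nat.sub_zero, List.replicate_zero, List.nil_append,
        Nat.add_sub_cancel, List.replicate_succ, List.cons_append]
      exact this.le
    | succ j ih =>
      intro hj
      have h1 := ih (by omega)
      have h2 := hlc j hj
      have h3 := hpos j (by omega)
      have h4 := hpos (j + 1) (by omega)
      have h5 : a (j + 2) * a j ≤ a (j + 1) * a j := by nlinarith
      exact le_of_mul_le_mul_right h5 h3
  have hle : ∀ j ≤ K, a j ≤ a 0 := by
    intro j
    induction j with
    | zero => exact fun _ => le_rfl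
    | succ j ih => exact fun hj => (hmono j hj).trans (ih (by omega))
  have h := hle K le_rfl
  simp only [ha, Nat.sub_self, List.replicate_zero, List.append_nil, List.nil_append,
    Nat.sub_zero, mixedIndep_replicate_zero] at h
  exact le_of_mul_le_mul_left h (by exact_mod_cast K.factorial_pos)

end Matroid

theorem continuous_indepGenPoly {α : Type*} [Fintype α] (M : Matroid α) (K : ℕ) :
    Continuous (indepGenPoly M K) := by
  unfold indepGenPoly
  refine continuous_finsetSum _ fun S _ => ?_
  split_ifs
  · fun_prop
  · fun_prop

/-- **Uniform optimality for the independent-set generating polynomial of a transitive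
matroid.** For `1 ≤ K ≤ rank M`, every distribution `p` satisfies
`f_{M,K}(p) ≤ f_{M,K}(u) = |{S ∈ I(M) : |S| = K}| / |E|^K`, where `u` is the uniform
distribution. -/
theorem indepGenPoly_le_uniform_of_transitive {α : Type*} [Fintype α] (M : Matroid α)
    (hE : M.E = Set.univ) (K : ℕ) (hK : 1 ≤ K)
    (hrank : ∃ I : Finset α, M.Indep (I : Set α) ∧ I.card = K)
    (htrans : ∀ e e' : α, ∃ g : α ≃ α,
      (∀ S : Set α, M.Indep (g '' S) ↔ M.Indep S) ∧ g e = e')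
    (p : α → ℝ) (hp0 : ∀ e, 0 ≤ p e) (hp1 : ∑ e, p e = 1) :
    indepGenPoly M K p ≤ indepGenPoly M K (fun _ => (Fintype.card α : ℝ)⁻¹) ∧
    indepGenPoly M K (fun _ => (Fintype.card α : ℝ)⁻¹) =
      (((Finset.univ.powersetCard K).filter (fun S : Finset α => M.Indep (S : Set α))).card : ℝ)
        / (Fintype.card α : ℝ) ^ K := by
  have hcard : 0 < (Fintype.card α : ℝ) := by
    rcases isEmpty_or_nonempty α with h | h
    · simp at hp1
    · exact_mod_cast Fintype.card_pos
  set c : ℝ := (Fintype.card α : ℝ)⁻¹ with hc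
  have hc0 : 0 < c := inv_pos.2 hcard
  have hcsum : ∑ _e : α, c = 1 := by
    rw [Finset.sum_const, Finset.card_univ, nsmul_eq_mul, hc, mul_inv_cancel₀ hcard.ne']
  refine ⟨?_, ?_⟩
  · have hcont : Continuous fun t : ℝ => indepGenPoly M K fun e => (1 - t) * p e + t * c :=
      (continuous_indepGenPoly M K).comp (by fun_prop)
    have hlim := (hcont.tendsto 0).mono_left (nhdsWithin_le_nhds (s := Set.Ioi 0))
    simp only [sub_zero, one_mul, zero_mul, add_zero] at hlim
    refine le_of_tendsto hlim ?_
    filter_upwards [Ioo_mem_nhdsGT (zero_lt_one' ℝ)] with t ht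
    refine Matroid.indepGenPoly_le_const_of_pos hE hrank htrans (fun e => ?_) hc0 ?_
    · exact add_pos_of_nonneg_of_pos (mul_nonneg (by linarith [ht.2]) (hp0 e))
        (mul_pos ht.1 hc0)
    · rw [Finset.sum_add_distrib, ← Finset.mul_sum, ← Finset.mul_sum, hp1, hcsum]
      ring
  · rw [indepGenPoly, ← Finset.sum_filter, Finset.sum_congr rfl fun S hS => by
      rw [Finset.prod_const, (Finset.mem_powersetCard.1 (Finset.mem_filter.1 hS).1).2],
      Finset.sum_const, nsmul_eq_mul, hc, inv_pow, div_eq_mul_inv]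
end
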